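/- Let τ be in the complex upper half-plane and let u ∈ ℂ with u ∉ ℤτ + (1/2)ℤ. Then ϑ(u;τ)³ · (8πi ∂/∂τ + ∂²/∂u²)[ η(2τ)⁴ / ( η(τ)² ϑ(2u;2τ) ) + e^{−πiτ/2} e^{2πiu} μ(2u, τ; 2τ) ] = −4π² ( η(τ)⁸ / η(2τ) ) ϑ(u + 1/2; τ), where the differential operator is applied to the bracketed expression as a function of (u,τ). -/

import Mathlib

open Complex Real Filter

noncomputable section

/-- The Jacobi theta function ϑ(u;τ) = Σ_{ν∈ℤ+1/2} e^{πiν²τ + 2πiν(u+1/2)}. -/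
def jTheta (u τ : ℂ) : ℂ :=
  ∑' n : ℤ, Complex.exp (π * I * ((n : ℂ) + 1/2)^2 * τ + 2 * π * I * ((n : ℂ) + 1/2) * (u + 1/2))

/-- ϑ₀(u;τ) = Σ_{n∈ℤ} e^{πin²τ + 2πinu}. -/
def jTheta0 (u τ : ℂ) : ℂ :=
  ∑' n : ℤ, Complex.exp (π * I * (n : ℂ)^2 * τ + 2 * π * I * (n : ℂ) * u)

/-- ϑ₁(u;τ) = Σ_{n∈1/2+ℤ} e^{πin²τ + 2πinu}. -/
def jTheta1 (u τ : ℂ) : ℂ :=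
  ∑' n : ℤ, Complex.exp (π * I * ((n : ℂ) + 1/2)^2 * τ + 2 * π * I * ((n : ℂ) + 1/2) * u)

/-- The Dedekind eta function. -/
def dedekindEta (τ : ℂ) : ℂ :=
  Complex.exp (π * I * τ / 12) * ∏' n : ℕ, (1 - Complex.exp (2 * π * I * ((n : ℂ) + 1) * τ))

/-- The Lerch sum μ(u,v;τ). -/
def lerchMu (u v τ : ℂ) : ℂ :=
  Complex.exp (π * I * u) / jTheta v τ *
    ∑' n : ℤ, (-1 : ℂ) ^ n * Complex.exp (π * I * ((n : ℂ)^2 + (n : ℂ)) * τ + 2 * π * I * v * (n : ℂ)) /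
      (1 - Complex.exp (2 * π * I * (n : ℂ) * τ + 2 * π * I * u))

/-- a₀^{α,β}(τ). -/
def aCoef0 (α β : ℝ) (τ : ℂ) : ℂ :=
  ∑' n : ℤ, ((n : ℂ) + (α : ℂ)/2) *
    Complex.exp (2 * π * I * (n : ℂ)^2 * τ + 2 * π * I * (n : ℂ) * ((α : ℂ) * τ + (β : ℂ)))

/-- a₁^{α,β}(τ). -/
def aCoef1 (α β : ℝ) (τ : ℂ) : ℂ :=
  ∑' n : ℤ, (((n : ℂ) + 1/2) + (α : ℂ)/2) *
    Complex.exp (2 * π * I * ((n : ℂ) + 1/2)^2 * τ + 2 * π * I * ((n : ℂ) + 1/2) * ((α : ℂ) * τ + (β : ℂ)))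

/-- Finite q-Pochhammer symbol (a;q)_n. -/
def qPochN (a q : ℂ) (n : ℕ) : ℂ := ∏ j ∈ Finset.range n, (1 - a * q ^ j)

/-- Infinite q-Pochhammer symbol (a;q)_∞. -/
def qPochInf (a q : ℂ) : ℂ := ∏' j : ℕ, (1 - a * q ^ j)

/-- The modified rank generating function R*(z;q). -/
def rankStar (z q : ℂ) : ℂ :=
  (qPochInf q q)⁻¹ * ∑' n : ℤ, (-1 : ℂ) ^ n * q ^ (n * (3 * n + 1) / 2) / (1 - z * q ^ n)

/-- The modified crank generating function C*(z;q). -/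
def crankStar (z q : ℂ) : ℂ :=
  (1 - z)⁻¹ * ∏' n : ℕ, ((1 - q ^ (n + 1)) / ((1 - z * q ^ (n + 1)) * (1 - z⁻¹ * q ^ (n + 1))))

/-- N(1,0,z;q), the overpartition-rank generating function. -/
def nGen10 (z q : ℂ) : ℂ :=
  ∑' n : ℕ, qPochN (-1) q n * q ^ (n * (n + 1) / 2) / (qPochN (z * q) q n * qPochN (z⁻¹ * q) q n)

/-- N*(1,0,z;q). -/
def nStar10 (z q : ℂ) : ℂ := nGen10 z q / (1 - z)

/-- N(1,1/q,z;q²), the M2-rank generating function for overpartitions. -/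
def nGenM2over (z q : ℂ) : ℂ :=
  ∑' n : ℕ, qPochN (-1) (q^2) n * qPochN (-q) (q^2) n * q ^ n /
    (qPochN (z * q^2) (q^2) n * qPochN (z⁻¹ * q^2) (q^2) n)

/-- N*(1,1/q,z;q²). -/
def nStarM2over (z q : ℂ) : ℂ := nGenM2over z q / (1 - z)

/-- N(0,1/q,z;q²), the M2-rank generating function for partitions without repeated odd parts. -/
def nGenM2 (z q : ℂ) : ℂ :=
  ∑' n : ℕ, qPochN (-q) (q^2) n * q ^ (n^2) /
    (qPochN (z * q^2) (q^2) n * qPochN (z⁻¹ * q^2) (q^2) n)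

/-- N*(0,1/q,z;q²). -/
def nStarM2 (z q : ℂ) : ℂ := nGenM2 z q / (1 - z)

/-- The odd-rank generating function R^o(z;q). -/
def oddRank (z q : ℂ) : ℂ :=
  (qPochInf (q^2) (q^2))⁻¹ * ∑' n : ℤ, (-1 : ℂ) ^ n * q ^ (3 * n^2 + 3 * n + 1) / (1 - z * q ^ (2 * n + 1))

/-- The reciprocal of `∏ k < m, (1 - q ^ (k + 1))`, extended by zero to negative `m`. -/
def invPoch (q : ℂ) (m : ℤ) : ℂ :=
  if m < 0 then 0 else (∏ k ∈ Finset.range m.toNat, (1 - q ^ (k + 1)))⁻¹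

lemma invPoch_natCast (q : ℂ) (m : ℕ) :
    invPoch q m = (∏ k ∈ Finset.range m, (1 - q ^ (k + 1)))⁻¹ := by
  simp [invPoch]

lemma invPoch_sub_one {q : ℂ} (hq : ∀ k : ℕ, 1 - q ^ (k + 1) ≠ 0) (m : ℤ) :
    invPoch q (m - 1) = (1 - q ^ m) * invPoch q m := by
  rcases lt_trichotomy m 0 with h | rfl | h
  · simp [invPoch, h, show m - 1 < 0 by omega]
  · simp [invPoch]
  · obtain ⟨k, rfl⟩ : ∃ k : ℕ, m = k + 1 := ⟨(m - 1).toNat, by omega⟩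
    rw [add_sub_cancel_right, invPoch_natCast, show (k : ℤ) + 1 = ((k + 1 : ℕ) : ℤ) by push_cast; rfl,
      invPoch_natCast, Finset.prod_range_succ, zpow_natCast]
    have := hq k
    field_simp

lemma one_sub_pow_succ_ne_zero {q : ℂ} (hq : ‖q‖ < 1) (k : ℕ) : 1 - q ^ (k + 1) ≠ 0 := by
  intro h
  have h1 : ‖q ^ (k + 1)‖ < 1 := by
    rw [norm_pow]; exact pow_lt_one₀ (norm_nonneg _) hq (by omega)
  rw [← sub_eq_zero.mp h] at h1
  simp at h1

/-- The finite form of the Jacobi triple product. -/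
lemma hasSum_finite_triple_product {p z : ℂ} (hp0 : p ≠ 0) (hp : ‖p‖ < 1) (hz : z ≠ 0) (n : ℕ) :
    HasSum (fun j : ℤ ↦ (∏ k ∈ Finset.range (2 * n), (1 - (p ^ 2) ^ (k + 1))) *
        invPoch (p ^ 2) (n + j) * invPoch (p ^ 2) (n - j) * (p ^ (j ^ 2) * z ^ j))
      (∏ k ∈ Finset.range n, ((1 + z * p ^ (2 * k + 1)) * (1 + z⁻¹ * p ^ (2 * k + 1)))) := by
  have hq : ∀ k : ℕ, 1 - (p ^ 2) ^ (k + 1) ≠ 0 := one_sub_pow_succ_ne_zero (by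
    rw [norm_pow]; exact pow_lt_one₀ (norm_nonneg _) hp two_ne_zero)
  induction n with
  | zero =>
    convert hasSum_single (0 : ℤ) ?_ using 1
    · simp [invPoch]
    · intro j hj
      rcases lt_or_gt_of_ne hj with h | h
      · simp [invPoch, h]
      · simp [invPoch, h]
  | succ n ih =>
    have h1 := (Equiv.subRight (1 : ℤ)).hasSum_iff.mpr ih
    have h2 := (Equiv.addRight (1 : ℤ)).hasSum_iff.mpr ih
    have h := ((ih.mul_left (1 + p ^ (4 * n + 2))).add (h1.mul_left (p ^ (2 * n + 1) * z))).add
      (h2.mul_left (p ^ (2 * n + 1) * z⁻¹))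
    have hP : ∏ k ∈ Finset.range (n + 1), ((1 + z * p ^ (2 * k + 1)) * (1 + z⁻¹ * p ^ (2 * k + 1))) =
        (1 + p ^ (4 * n + 2)) *
          ∏ k ∈ Finset.range n, ((1 + z * p ^ (2 * k + 1)) * (1 + z⁻¹ * p ^ (2 * k + 1))) +
        p ^ (2 * n + 1) * z *
          ∏ k ∈ Finset.range n, ((1 + z * p ^ (2 * k + 1)) * (1 + z⁻¹ * p ^ (2 * k + 1))) +
        p ^ (2 * n + 1) * z⁻¹ *
          ∏ k ∈ Finset.range n, ((1 + z * p ^ (2 * k + 1)) * (1 + z⁻¹ * p ^ (2 * k + 1))) := by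
      rw [Finset.prod_range_succ]
      field_simp
      ring
    rw [hP]
    refine (congrArg (fun f ↦ HasSum f _) (funext fun j ↦ ?_)).mpr h
    · clear hP h h1 h2 ih
      simp only [Function.comp, Equiv.subRight_apply, Equiv.coe_addRight]
      set R := invPoch (p ^ 2) with hR
      have r1 : R (n + j) = (1 - (p ^ 2) ^ (n + 1 + j : ℤ)) * R (n + 1 + j) := by
        rw [hR, ← invPoch_sub_one hq]; congr 1; ring
      have r2 : R (n - j) = (1 - (p ^ 2) ^ (n + 1 - j : ℤ)) * R (n + 1 - j) := by
        rw [hR, ← invPoch_sub_one hq]; congr 1; ring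
      have r3 : R (n + (j - 1)) = (1 - (p ^ 2) ^ (n + j : ℤ)) * R (n + j) := by
        rw [hR, ← invPoch_sub_one hq]; congr 1; ring
      have r4 : R (n - (j + 1)) = (1 - (p ^ 2) ^ (n - j : ℤ)) * R (n - j) := by
        rw [hR, ← invPoch_sub_one hq]; congr 1; ring
      have r5 : R (n + (j + 1)) = R (n + 1 + j) := by congr 1; ring
      have r6 : R (n - (j - 1)) = R (n + 1 - j) := by congr 1; ring
      rw [r3, r4, r5, r6, r1, r2]
      have z1 : z ^ (j - 1) = z ^ j * z⁻¹ := by rw [zpow_sub_one₀ hz]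
      have z2 : z ^ (j + 1) = z ^ j * z := by rw [zpow_add_one₀ hz]
      have hp2 : p ^ 2 ≠ 0 := pow_ne_zero _ hp0
      have e1 : (p ^ 2) ^ (n + j : ℤ) = (p ^ 2) ^ (n + 1 + j : ℤ) * (p ^ 2)⁻¹ := by
        rw [← zpow_sub_one₀ hp2]; congr 1; ring
      have e2 : (p ^ 2) ^ (n - j : ℤ) = (p ^ 2) ^ (n + 1 - j : ℤ) * (p ^ 2)⁻¹ := by
        rw [← zpow_sub_one₀ hp2]; congr 1; ring
      have e3 : p ^ ((j - 1) ^ 2 : ℤ) * p ^ (2 * n + 1) = p ^ (j ^ 2) * (p ^ 2) ^ (n + 1 - j : ℤ) := by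
        rw [← zpow_natCast p 2, ← zpow_mul, ← zpow_natCast p (2 * n + 1), ← zpow_add₀ hp0,
          ← zpow_add₀ hp0]
        congr 1; push_cast; ring
      have e4 : p ^ ((j + 1) ^ 2 : ℤ) * p ^ (2 * n + 1) = p ^ (j ^ 2) * (p ^ 2) ^ (n + 1 + j : ℤ) := by
        rw [← zpow_natCast p 2, ← zpow_mul, ← zpow_natCast p (2 * n + 1), ← zpow_add₀ hp0,
          ← zpow_add₀ hp0]
        congr 1; push_cast; ring
      have e5 : (p ^ 2) ^ (n + 1 + j : ℤ) * (p ^ 2) ^ (n + 1 - j : ℤ) = p ^ (4 * n + 4) := by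
        rw [← zpow_add₀ hp2, ← zpow_natCast p 2, ← zpow_mul, ← zpow_natCast p (4 * n + 4)]
        congr 1; push_cast; ring
      rw [z1, z2, e1, e2, show 2 * (n + 1) = 2 * n + 1 + 1 by ring, Finset.prod_range_succ,
        Finset.prod_range_succ]
      push_cast
      rw [show (p ^ 2) ^ (2 * n + 1) = p ^ (4 * n + 4) * (p ^ 2)⁻¹ by field_simp; ring,
        show (p ^ 2) ^ (2 * n + 1 + 1) = p ^ (4 * n + 4) by rw [← pow_mul]; congr 1; ring,
        show p ^ (4 * n + 2) = p ^ (4 * n + 4) * (p ^ 2)⁻¹ by field_simp; ring, ← e5]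
      set X := (p ^ 2) ^ (n + 1 + j : ℤ)
      set Y := (p ^ 2) ^ (n + 1 - j : ℤ)
      set Q := ∏ x ∈ Finset.range (2 * n), (1 - (p ^ 2) ^ (x + 1))
      set A := R (n + 1 + j)
      set B := R (n + 1 - j)
      have hzz : z * z⁻¹ = 1 := mul_inv_cancel₀ hz
      linear_combination (norm := skip)
        (-(Q * ((1 - X * (p ^ 2)⁻¹) * ((1 - X) * A)) * B * z ^ j)) * e3
        + (-(Q * A * ((1 - Y * (p ^ 2)⁻¹) * ((1 - Y) * B)) * z ^ j)) * e4
      field_simp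
      ring

lemma summable_norm_pow_succ {q : ℂ} (hq : ‖q‖ < 1) (a : ℂ) :
    Summable fun k : ℕ ↦ ‖a * q ^ (k + 1)‖ := by
  simp_rw [norm_mul, norm_pow]
  exact ((summable_nat_add_iff 1).mpr (summable_geometric_of_lt_one (norm_nonneg _) hq)).mul_left _

lemma tprod_one_sub_mul_pow_ne_zero {q a : ℂ} (hq : ‖q‖ < 1)
    (h : ∀ k : ℕ, 1 - a * q ^ (k + 1) ≠ 0) : ∏' k : ℕ, (1 - a * q ^ (k + 1)) ≠ 0 := by
  simp_rw [sub_eq_add_neg] at h ⊢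
  exact tprod_one_add_ne_zero_of_summable h (by simpa using summable_norm_pow_succ hq a)

lemma multipliable_one_sub_mul_pow {q : ℂ} (hq : ‖q‖ < 1) (a : ℂ) :
    Multipliable fun k : ℕ ↦ (1 - a * q ^ (k + 1)) := by
  simp_rw [sub_eq_add_neg]
  exact multipliable_one_add_of_summable (by simpa using summable_norm_pow_succ hq a)

/-- The Jacobi triple product. -/
theorem tsum_eq_triple_product {p z : ℂ} (hp0 : p ≠ 0) (hp : ‖p‖ < 1) (hz : z ≠ 0)
    (hs : Summable fun j : ℤ ↦ ‖p ^ (j ^ 2) * z ^ j‖) :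
    ∑' j : ℤ, p ^ (j ^ 2) * z ^ j = (∏' k : ℕ, (1 - (p ^ 2) ^ (k + 1))) *
      ((∏' k : ℕ, (1 + z * p ^ (2 * k + 1))) * ∏' k : ℕ, (1 + z⁻¹ * p ^ (2 * k + 1))) := by
  have hq1 : ‖p ^ 2‖ < 1 := by rw [norm_pow]; exact pow_lt_one₀ (norm_nonneg _) hp two_ne_zero
  have hm := multipliable_one_sub_mul_pow hq1 1
  have hne := tprod_one_sub_mul_pow_ne_zero (a := 1) hq1
    (by simpa using one_sub_pow_succ_ne_zero hq1)
  simp only [one_mul] at hm hne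
  set Q := ∏' k : ℕ, (1 - (p ^ 2) ^ (k + 1)) with hQ
  have hQt : Tendsto (fun n ↦ ∏ k ∈ Finset.range n, (1 - (p ^ 2) ^ (k + 1))) atTop (nhds Q) :=
    hm.hasProd.tendsto_prod_nat
  have hRt : Tendsto (fun n : ℕ ↦ invPoch (p ^ 2) n) atTop (nhds Q⁻¹) := by
    simp_rw [invPoch_natCast]; exact hQt.inv₀ hne
  obtain ⟨B, hB⟩ := hQt.norm.bddAbove_range
  obtain ⟨C, hC⟩ := hRt.norm.bddAbove_range
  have hB' (n : ℕ) : ‖∏ k ∈ Finset.range n, (1 - (p ^ 2) ^ (k + 1))‖ ≤ B := hB ⟨n, rfl⟩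
  have hC0 : 0 ≤ C := (norm_nonneg _).trans (hC ⟨0, rfl⟩)
  have hB0 : 0 ≤ B := (norm_nonneg _).trans (hB' 0)
  have hC' (m : ℤ) : ‖invPoch (p ^ 2) m‖ ≤ C := by
    rcases lt_or_ge m 0 with h | h
    · simpa [invPoch, h] using hC0
    · lift m to ℕ using h
      exact hC ⟨m, rfl⟩
  have hm1 (w : ℂ) : Multipliable fun k : ℕ ↦ (1 + w * p ^ (2 * k + 1)) := by
    refine multipliable_one_add_of_summable ?_
    have := (summable_norm_pow_succ hq1 (w * p⁻¹))
    refine this.congr fun k ↦ ?_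
    congr 1; field_simp; ring
  have hprod : Tendsto (fun n : ℕ ↦ ∏ k ∈ Finset.range n,
      ((1 + z * p ^ (2 * k + 1)) * (1 + z⁻¹ * p ^ (2 * k + 1)))) atTop
      (nhds ((∏' k : ℕ, (1 + z * p ^ (2 * k + 1))) * ∏' k : ℕ, (1 + z⁻¹ * p ^ (2 * k + 1)))) := by
    simp_rw [Finset.prod_mul_distrib]
    exact (hm1 z).hasProd.tendsto_prod_nat.mul (hm1 z⁻¹).hasProd.tendsto_prod_nat
  simp_rw [← fun n ↦ (hasSum_finite_triple_product hp0 hp hz n).tsum_eq] at hprod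
  have hsum := tendsto_tsum_of_dominated_convergence (𝓕 := atTop)
    (f := fun (n : ℕ) (j : ℤ) ↦ (∏ k ∈ Finset.range (2 * n), (1 - (p ^ 2) ^ (k + 1))) *
        invPoch (p ^ 2) (n + j) * invPoch (p ^ 2) (n - j) * (p ^ (j ^ 2) * z ^ j))
    (g := fun j : ℤ ↦ Q * Q⁻¹ * Q⁻¹ * (p ^ (j ^ 2) * z ^ j))
    (hs.mul_left (B * C * C)) (fun j ↦ ?_) (Eventually.of_forall fun n j ↦ ?_)
  · have := tendsto_nhds_unique hprod hsum
    rw [this, tsum_mul_left, ← mul_assoc, mul_assoc Q, mul_inv_cancel₀ hne]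
    field_simp
  · refine Tendsto.mul_const _ (Tendsto.mul (Tendsto.mul ?_ ?_) ?_)
    · exact hQt.comp (tendsto_id.const_mul_atTop' two_pos)
    · refine (hRt.comp (g := fun n : ℕ ↦ invPoch (p ^ 2) n) (f := fun n : ℕ ↦ (n + j).toNat)
        (tendsto_atTop.mpr fun b ↦ ?_)).congr' ?_
      · filter_upwards [eventually_ge_atTop (b + j.natAbs)] with n hn
        omega
      · filter_upwards [eventually_ge_atTop (j.natAbs)] with n hn
        simp only [Function.comp]
        congr 1; omega
    · refine (hRt.comp (g := fun n : ℕ ↦ invPoch (p ^ 2) n) (f := fun n : ℕ ↦ (n - j).toNat)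
        (tendsto_atTop.mpr fun b ↦ ?_)).congr' ?_
      · filter_upwards [eventually_ge_atTop (b + j.natAbs)] with n hn
        omega
      · filter_upwards [eventually_ge_atTop (j.natAbs)] with n hn
        simp only [Function.comp]
        congr 1; omega
  · rw [norm_mul, norm_mul, norm_mul]
    gcongr
    · exact hB' _
    · exact hC' _
    · exact hC' _

/-- The normalised exponential `u ↦ e^{2πiu}`. -/
def expTwoPi (u : ℂ) : ℂ := Complex.exp (2 * π * I * u)

lemma expTwoPi_add (u v : ℂ) : expTwoPi (u + v) = expTwoPi u * expTwoPi v := by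
  rw [expTwoPi, mul_add, Complex.exp_add]; rfl

lemma expTwoPi_ne_zero (u : ℂ) : expTwoPi u ≠ 0 := Complex.exp_ne_zero _

lemma expTwoPi_neg (u : ℂ) : expTwoPi (-u) = (expTwoPi u)⁻¹ := by
  rw [expTwoPi, mul_neg, Complex.exp_neg]; rfl

lemma expTwoPi_zero : expTwoPi 0 = 1 := by simp [expTwoPi]

lemma norm_expTwoPi (u : ℂ) : ‖expTwoPi u‖ = Real.exp (-(2 * π * u.im)) := by
  rw [expTwoPi, Complex.norm_exp]; simp

lemma expTwoPi_eq_one_iff {u : ℂ} : expTwoPi u = 1 ↔ ∃ n : ℤ, u = n := by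
  rw [expTwoPi, Complex.exp_eq_one_iff]
  refine exists_congr fun n ↦ ?_
  rw [mul_comm (n : ℂ)]
  exact mul_right_inj' Complex.two_pi_I_ne_zero

lemma expTwoPi_intCast (n : ℤ) : expTwoPi n = 1 := expTwoPi_eq_one_iff.mpr ⟨n, rfl⟩

lemma expTwoPi_int_mul (n : ℤ) (u : ℂ) : expTwoPi (n * u) = expTwoPi u ^ n := by
  rw [expTwoPi, expTwoPi, ← Complex.exp_int_mul]; congr 1; ring

lemma expTwoPi_nat_mul (n : ℕ) (u : ℂ) : expTwoPi (n * u) = expTwoPi u ^ n := by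
  rw [expTwoPi, expTwoPi, ← Complex.exp_nat_mul]; congr 1; ring

lemma expTwoPi_half : expTwoPi (1 / 2) = -1 := by
  rw [expTwoPi, show 2 * π * I * (1 / 2) = π * I by ring, Complex.exp_pi_mul_I]

lemma norm_expTwoPi_lt_one {τ : ℂ} (hτ : 0 < τ.im) : ‖expTwoPi τ‖ < 1 := by
  rw [norm_expTwoPi, Real.exp_lt_one_iff]
  have := mul_pos Real.two_pi_pos hτ
  linarith

lemma hasDerivAt_expTwoPi (u : ℂ) : HasDerivAt expTwoPi (2 * π * I * expTwoPi u) u := by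
  have := ((hasDerivAt_id u).const_mul (2 * π * I)).cexp
  rw [mul_one, mul_comm (Complex.exp _)] at this
  exact this

/-- The product `∏ (1 - a q^k)` over `k ≥ 1`. -/
def eulerProd (a q : ℂ) : ℂ := ∏' k : ℕ, (1 - a * q ^ (k + 1))

lemma dedekindEta_eq (τ : ℂ) :
    dedekindEta τ = Complex.exp (π * I * τ / 12) * eulerProd 1 (expTwoPi τ) := by
  rw [dedekindEta, eulerProd]
  congr 2
  ext k
  rw [one_mul, ← expTwoPi_nat_mul, expTwoPi]
  push_cast
  ring_nf

lemma dedekindEta_ne_zero {τ : ℂ} (hτ : 0 < τ.im) : dedekindEta τ ≠ 0 := by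
  rw [dedekindEta_eq]
  refine mul_ne_zero (Complex.exp_ne_zero _) (tprod_one_sub_mul_pow_ne_zero
    (norm_expTwoPi_lt_one hτ) ?_)
  simpa using one_sub_pow_succ_ne_zero (norm_expTwoPi_lt_one hτ)

lemma jacobiTheta₂_eq_prod {τ : ℂ} (hτ : 0 < τ.im) (v : ℂ) :
    jacobiTheta₂ v τ = eulerProd 1 (expTwoPi τ) *
      ((∏' k : ℕ, (1 + expTwoPi v * expTwoPi (τ / 2) ^ (2 * k + 1))) *
        ∏' k : ℕ, (1 + (expTwoPi v)⁻¹ * expTwoPi (τ / 2) ^ (2 * k + 1))) := by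
  have hterm (j : ℤ) :
      jacobiTheta₂_term j v τ = expTwoPi (τ / 2) ^ (j ^ 2) * expTwoPi v ^ j := by
    rw [← expTwoPi_int_mul, ← expTwoPi_int_mul, ← expTwoPi_add, jacobiTheta₂_term, expTwoPi]
    congr 1; push_cast; ring
  have hs := ((summable_jacobiTheta₂_term_iff v τ).mpr hτ).norm
  simp only [hterm] at hs
  have := tsum_eq_triple_product (expTwoPi_ne_zero (τ / 2))
    (norm_expTwoPi_lt_one (by simpa using hτ)) (expTwoPi_ne_zero v) hs
  rw [jacobiTheta₂]
  simp only [hterm]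
  rw [this, eulerProd, ← expTwoPi_nat_mul]
  simp only [one_mul, Nat.cast_ofNat, mul_div_cancel₀ τ (two_ne_zero (α := ℂ))]

lemma jTheta_eq_jacobiTheta₂ (u τ : ℂ) :
    jTheta u τ = Complex.exp (π * I * τ / 4 + π * I * (u + 1 / 2)) *
      jacobiTheta₂ (u + 1 / 2 + τ / 2) τ := by
  rw [jTheta, jacobiTheta₂, ← tsum_mul_left]
  congr 1
  ext n
  rw [jacobiTheta₂_term, ← Complex.exp_add]
  congr 1; ring

lemma differentiable_jTheta {τ : ℂ} (hτ : 0 < τ.im) : Differentiable ℂ fun u ↦ jTheta u τ := by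
  intro u
  simp_rw [jTheta_eq_jacobiTheta₂]
  have h1 := differentiableAt_jacobiTheta₂_fst (u + 1 / 2 + τ / 2) hτ
  have h2 : DifferentiableAt ℂ (fun u : ℂ ↦ u + 1 / 2 + τ / 2) u := by fun_prop
  exact DifferentiableAt.mul (by fun_prop)
    (DifferentiableAt.comp (g := fun v ↦ jacobiTheta₂ v τ) u h1 h2)

lemma jTheta_add_one (u τ : ℂ) : jTheta (u + 1) τ = -jTheta u τ := by
  rw [jTheta_eq_jacobiTheta₂, jTheta_eq_jacobiTheta₂,
    show u + 1 + 1 / 2 + τ / 2 = u + 1 / 2 + τ / 2 + 1 by ring, jacobiTheta₂_add_left,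
    show π * I * τ / 4 + π * I * (u + 1 + 1 / 2) =
      π * I * τ / 4 + π * I * (u + 1 / 2) + π * I by ring, Complex.exp_add, Complex.exp_pi_mul_I]
  ring

lemma jTheta_add_tau (u τ : ℂ) :
    jTheta (u + τ) τ = -(Complex.exp (-π * I * τ) * (expTwoPi u)⁻¹) * jTheta u τ := by
  rw [jTheta_eq_jacobiTheta₂, jTheta_eq_jacobiTheta₂,
    show u + τ + 1 / 2 + τ / 2 = u + 1 / 2 + τ / 2 + τ by ring, jacobiTheta₂_add_left',
    ← expTwoPi_neg, expTwoPi, ← mul_assoc, neg_mul, ← Complex.exp_add, ← Complex.exp_add]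
  have h (x : ℂ) : -Complex.exp x = Complex.exp (x + π * I) := by
    rw [Complex.exp_add, Complex.exp_pi_mul_I, mul_neg_one]
  rw [h, ← mul_assoc, ← Complex.exp_add]
  congr 1
  rw [Complex.exp_eq_exp_iff_exists_int]
  exact ⟨-1, by push_cast; ring⟩

lemma jTheta_eq_prod {τ : ℂ} (hτ : 0 < τ.im) (u : ℂ) :
    jTheta u τ = I * Complex.exp (π * I * τ / 4) * Complex.exp (π * I * u) *
      (1 - expTwoPi (-u)) * eulerProd 1 (expTwoPi τ) * eulerProd (expTwoPi u) (expTwoPi τ) *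
        eulerProd (expTwoPi (-u)) (expTwoPi τ) := by
  have hm := multipliable_one_sub_mul_pow (norm_expTwoPi_lt_one hτ) (expTwoPi (-u))
  have h1 (k : ℕ) : 1 + expTwoPi (u + 1 / 2 + τ / 2) * expTwoPi (τ / 2) ^ (2 * k + 1) =
      1 - expTwoPi u * expTwoPi τ ^ (k + 1) := by
    rw [expTwoPi_add, expTwoPi_add, expTwoPi_half, mul_assoc, ← pow_succ',
      show 2 * k + 1 + 1 = 2 * (k + 1) by ring, pow_mul, ← expTwoPi_nat_mul 2]
    push_cast
    rw [mul_div_cancel₀ τ (two_ne_zero (α := ℂ))]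
    ring
  have h2 (k : ℕ) : 1 + (expTwoPi (u + 1 / 2 + τ / 2))⁻¹ * expTwoPi (τ / 2) ^ (2 * k + 1) =
      1 - expTwoPi (-u) * expTwoPi τ ^ k := by
    rw [expTwoPi_add, expTwoPi_add, expTwoPi_half, expTwoPi_neg, pow_succ, pow_mul,
      ← expTwoPi_nat_mul 2]
    push_cast
    rw [mul_div_cancel₀ τ (two_ne_zero (α := ℂ))]
    have := expTwoPi_ne_zero u
    have := expTwoPi_ne_zero (τ / 2)
    field_simp
    ring
  rw [jTheta_eq_jacobiTheta₂, jacobiTheta₂_eq_prod hτ]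
  simp only [h1, h2]
  rw [tprod_eq_zero_mul' (f := fun k ↦ 1 - expTwoPi (-u) * expTwoPi τ ^ k) hm, ← eulerProd, ← eulerProd, Complex.exp_add,
    show π * I * (u + 1 / 2) = π / 2 * I + π * I * u by ring, Complex.exp_add,
    Complex.exp_pi_div_two_mul_I]
  ring

lemma jTheta_ne_zero {τ u : ℂ} (hτ : 0 < τ.im) (hu : ∀ n : ℤ, expTwoPi (u + n * τ) ≠ 1) :
    jTheta u τ ≠ 0 := by
  have hq := norm_expTwoPi_lt_one hτ
  have h0 : expTwoPi u ≠ 1 := by simpa using hu 0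
  have h0' : 1 - expTwoPi (-u) ≠ 0 := by
    rw [expTwoPi_neg, sub_ne_zero, ne_comm, Ne, inv_eq_one]; exact h0
  rw [jTheta_eq_prod hτ]
  refine mul_ne_zero (mul_ne_zero (mul_ne_zero (mul_ne_zero (by simp) h0') ?_) ?_) ?_
  · exact tprod_one_sub_mul_pow_ne_zero hq (by simpa using one_sub_pow_succ_ne_zero hq)
  · refine tprod_one_sub_mul_pow_ne_zero hq fun k ↦ ?_
    have := hu (k + 1)
    rw [expTwoPi_add, expTwoPi_int_mul] at this
    rw [sub_ne_zero, ne_comm]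
    exact_mod_cast this
  · refine tprod_one_sub_mul_pow_ne_zero hq fun k ↦ ?_
    have := hu (-(k + 1))
    rw [Int.cast_neg, neg_mul, ← neg_neg u, ← neg_add, expTwoPi_neg, expTwoPi_add,
      expTwoPi_int_mul, Ne, inv_eq_one] at this
    rw [sub_ne_zero, ne_comm]
    exact_mod_cast this

lemma tendsto_eulerProd {q : ℂ} (hq : ‖q‖ < 1) {α : Type*} {l : Filter α} {f : α → ℂ} {a : ℂ}
    (hf : Tendsto f l (nhds a)) : Tendsto (fun x ↦ eulerProd (f x) q) l (nhds (eulerProd a q)) := by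
  simp_rw [eulerProd, sub_eq_add_neg]
  refine tendsto_tprod_one_add_of_dominated_convergence
    (bound := fun k ↦ (‖a‖ + 1) * ‖1 * q ^ (k + 1)‖) ((summable_norm_pow_succ hq 1).mul_left _)
    (fun k ↦ (hf.mul_const _).neg) ?_
  filter_upwards [hf.norm.eventually_lt_const (lt_add_one ‖a‖)] with x hx k
  rw [norm_neg, norm_mul, one_mul]
  gcongr

lemma tendsto_expTwoPi_sub_one_div :
    Tendsto (fun u ↦ u⁻¹ * (expTwoPi u - 1)) (nhdsWithin 0 {0}ᶜ) (nhds (2 * π * I)) := by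
  have := (hasDerivAt_expTwoPi 0).tendsto_slope_zero
  simpa [expTwoPi_zero] using this

lemma continuous_expTwoPi : Continuous expTwoPi := by unfold expTwoPi; fun_prop

lemma tendsto_jTheta_div {τ : ℂ} (hτ : 0 < τ.im) :
    Tendsto (fun u ↦ u⁻¹ * jTheta u τ) (nhdsWithin 0 {0}ᶜ)
      (nhds (-2 * π * dedekindEta τ ^ 3)) := by
  have hq := norm_expTwoPi_lt_one hτ
  have hc1 : Tendsto (fun u : ℂ ↦ Complex.exp (π * I * u)) (nhdsWithin 0 {0}ᶜ) (nhds 1) := by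
    have : Continuous (fun u : ℂ ↦ Complex.exp (π * I * u)) := by fun_prop
    simpa using (this.tendsto 0).mono_left nhdsWithin_le_nhds
  have hc2 : Tendsto expTwoPi (nhdsWithin 0 {0}ᶜ) (nhds 1) := by
    simpa [expTwoPi_zero] using (continuous_expTwoPi.tendsto 0).mono_left nhdsWithin_le_nhds
  have hc3 : Tendsto (fun u ↦ expTwoPi (-u)) (nhdsWithin 0 {0}ᶜ) (nhds 1) := by
    have : Continuous fun u ↦ expTwoPi (-u) := continuous_expTwoPi.comp continuous_neg
    simpa [expTwoPi_zero] using (this.tendsto 0).mono_left nhdsWithin_le_nhds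
  have h := (((((hc1.const_mul (I * Complex.exp (π * I * τ / 4))).mul
    (tendsto_expTwoPi_sub_one_div.mul hc3)).mul_const (eulerProd 1 (expTwoPi τ))).mul
      (tendsto_eulerProd hq hc2)).mul (tendsto_eulerProd hq hc3))
  convert h using 1
  · ext u
    rw [jTheta_eq_prod hτ, show 1 - expTwoPi (-u) = (expTwoPi u - 1) * expTwoPi (-u) by
      rw [expTwoPi_neg, sub_mul, mul_inv_cancel₀ (expTwoPi_ne_zero u), one_mul]]
    ring
  · rw [dedekindEta_eq, mul_pow, ← Complex.exp_nat_mul,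
      show ((3 : ℕ) : ℂ) * (π * I * τ / 12) = π * I * τ / 4 by push_cast; ring]
    congr 1
    linear_combination (-2 * π * Complex.exp (π * I * τ / 4) * eulerProd 1 (expTwoPi τ) ^ 3) * I_sq

lemma eulerProd_one_eq_odd_mul {q : ℂ} (hq : ‖q‖ < 1) :
    eulerProd 1 q = (∏' k : ℕ, (1 - q ^ (2 * k + 1))) * eulerProd 1 (q ^ 2) := by
  have hq2 : ‖q ^ 2‖ < 1 := by rw [norm_pow]; exact pow_lt_one₀ (norm_nonneg _) hq two_ne_zero
  have h2 := multipliable_one_sub_mul_pow hq2 1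
  have h1 : Multipliable fun k : ℕ ↦ (1 - q ^ (2 * k + 1)) := by
    rcases eq_or_ne q 0 with rfl | h0
    · simp
    refine (multipliable_one_sub_mul_pow hq2 q⁻¹).congr fun k ↦ ?_
    field_simp
    ring
  rw [eulerProd, eulerProd]
  simp only [one_mul] at h2 ⊢
  rw [← tprod_even_mul_odd (f := fun k ↦ 1 - q ^ (k + 1)) h1
    (h2.congr fun k ↦ by rw [← pow_mul]; congr 2)]
  congr 2
  ext k
  rw [← pow_mul]; congr 2

lemma theta_four_mul_eta {τ : ℂ} (hτ : 0 < τ.im) :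
    jacobiTheta₂ (1 / 2) (2 * τ) * dedekindEta (2 * τ) = dedekindEta τ ^ 2 := by
  have hτ2 : 0 < (2 * τ).im := by simpa using hτ
  have hq := norm_expTwoPi_lt_one hτ
  have hsq : expTwoPi (2 * τ) = expTwoPi τ ^ 2 := by exact_mod_cast expTwoPi_nat_mul 2 τ
  rw [jacobiTheta₂_eq_prod hτ2, expTwoPi_half, mul_div_cancel_left₀ τ (two_ne_zero (α := ℂ)),
    dedekindEta_eq, dedekindEta_eq, eulerProd_one_eq_odd_mul hq, hsq, mul_pow,
    ← Complex.exp_nat_mul]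
  simp only [inv_neg, inv_one, neg_mul, one_mul, ← sub_eq_add_neg]
  rw [show ((2 : ℕ) : ℂ) * (π * I * τ / 12) = π * I * (2 * τ) / 12 by push_cast; ring]
  ring

lemma jTheta_half_mul_eta {τ : ℂ} (hτ : 0 < τ.im) :
    jTheta (1 / 2) τ * dedekindEta τ = -2 * dedekindEta (2 * τ) ^ 2 := by
  have hq := norm_expTwoPi_lt_one hτ
  have hsq : expTwoPi (2 * τ) = expTwoPi τ ^ 2 := by exact_mod_cast expTwoPi_nat_mul 2 τ
  have h1 : eulerProd 1 (expTwoPi τ) * eulerProd (-1) (expTwoPi τ) =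
      eulerProd 1 (expTwoPi (2 * τ)) := by
    rw [eulerProd, eulerProd, eulerProd, hsq, ← (multipliable_one_sub_mul_pow hq 1).tprod_mul
      (multipliable_one_sub_mul_pow hq (-1))]
    congr 1; ext k; ring
  rw [jTheta_eq_prod hτ, expTwoPi_neg, expTwoPi_half, dedekindEta_eq, dedekindEta_eq, ← h1,
    mul_pow, mul_pow, ← Complex.exp_nat_mul, show π * I * (1 / 2) = π / 2 * I by ring,
    Complex.exp_pi_div_two_mul_I,
    show ((2 : ℕ) : ℂ) * (π * I * (2 * τ) / 12) = π * I * τ / 4 + π * I * τ / 12 by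
      push_cast; ring, Complex.exp_add]
  norm_num
  linear_combination (2 * Complex.exp (π * I * τ / 4) * eulerProd 1 (expTwoPi τ) ^ 2 *
    eulerProd (-1) (expTwoPi τ) ^ 2 * Complex.exp (π * I * τ / 12)) * I_sq

/-- The function `u ↦ ζ / (1 - ζ)` with `ζ = e^{2πiu}`. -/
def lamFun (u : ℂ) : ℂ := expTwoPi u / (1 - expTwoPi u)

lemma hasDerivAt_lamFun {u : ℂ} (hu : expTwoPi u ≠ 1) :
    HasDerivAt lamFun (2 * π * I * (lamFun u + lamFun u ^ 2)) u := by
  have h1 : 1 - expTwoPi u ≠ 0 := sub_ne_zero.mpr hu.symm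
  have := (hasDerivAt_expTwoPi u).div ((hasDerivAt_expTwoPi u).const_sub 1) h1
  refine this.congr_deriv ?_
  rw [lamFun]
  field_simp
  ring

lemma lamFun_add_one (u : ℂ) : lamFun (u + 1) = lamFun u := by
  rw [lamFun, expTwoPi_add, show expTwoPi 1 = 1 by exact_mod_cast expTwoPi_intCast 1, mul_one]; rfl

lemma two_le_exp_two_pi : 2 ≤ Real.exp (2 * π) := by
  have := Real.add_one_le_exp (2 * π)
  have := Real.pi_gt_three
  linarith

lemma lamFun_bound_of_one_le_im {u : ℂ} (hu : 1 ≤ u.im) :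
    expTwoPi u ≠ 1 ∧ ‖lamFun u‖ ≤ 2 := by
  have h : ‖expTwoPi u‖ ≤ 1 / 2 := by
    rw [norm_expTwoPi, Real.exp_neg, one_div]
    refine inv_anti₀ two_pos (two_le_exp_two_pi.trans (Real.exp_le_exp.mpr ?_))
    exact le_mul_of_one_le_right Real.two_pi_pos.le hu
  have h1 : 1 / 2 ≤ ‖1 - expTwoPi u‖ := by
    have := norm_sub_norm_le 1 (expTwoPi u)
    rw [norm_one] at this
    linarith
  refine ⟨fun h' ↦ ?_, ?_⟩
  · rw [h', norm_one] at h; norm_num at h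
  · rw [lamFun, norm_div, div_le_iff₀ (by linarith)]
    linarith

lemma lamFun_bound_of_im_le {u : ℂ} (hu : u.im ≤ -1) :
    expTwoPi u ≠ 1 ∧ ‖lamFun u‖ ≤ 2 := by
  have h : 2 ≤ ‖expTwoPi u‖ := by
    rw [norm_expTwoPi]
    refine two_le_exp_two_pi.trans (Real.exp_le_exp.mpr ?_)
    nlinarith [Real.two_pi_pos]
  have h1 : ‖expTwoPi u‖ - 1 ≤ ‖1 - expTwoPi u‖ := by
    have := norm_sub_norm_le (expTwoPi u) 1
    rw [norm_one, norm_sub_rev] at this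
    linarith
  refine ⟨fun h' ↦ ?_, ?_⟩
  · rw [h', norm_one] at h; norm_num at h
  · rw [lamFun, norm_div, div_le_iff₀ (by linarith)]
    linarith

/-- Off its poles, the family `ζqⁿ / (1 - ζqⁿ)` is locally bounded uniformly in `n`. -/
lemma eventually_lamFun_bound {u₀ τ₀ : ℂ} (hτ : 0 < τ₀.im) {s : Set ℤ}
    (hs : ∀ n ∈ s, expTwoPi (u₀ + n * τ₀) ≠ 1) :
    ∃ C, ∀ᶠ p : ℂ × ℂ in nhds (u₀, τ₀), ∀ n ∈ s,
      expTwoPi (p.1 + n * p.2) ≠ 1 ∧ ‖lamFun (p.1 + n * p.2)‖ ≤ C := by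
  obtain ⟨N, hN⟩ := exists_nat_gt ((|u₀.im| + 2) / (τ₀.im / 2))
  rw [div_lt_iff₀ (by linarith)] at hN
  have hpt (n : ℤ) : Tendsto (fun p : ℂ × ℂ ↦ p.1 + n * p.2) (nhds (u₀, τ₀))
      (nhds (u₀ + n * τ₀)) := by
    have : Continuous fun p : ℂ × ℂ ↦ p.1 + n * p.2 := by fun_prop
    exact this.tendsto (u₀, τ₀)
  have hfin : ∀ᶠ p : ℂ × ℂ in nhds (u₀, τ₀), ∀ n ∈ Finset.Icc (-N : ℤ) N, n ∈ s →
      expTwoPi (p.1 + n * p.2) ≠ 1 ∧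
        ‖lamFun (p.1 + n * p.2)‖ < ‖lamFun (u₀ + n * τ₀)‖ + 1 := by
    rw [Filter.eventually_all_finset]
    intro n _
    by_cases hn : n ∈ s
    · have h1 := (continuous_expTwoPi.tendsto _).comp (hpt n)
      have h2 := ((hasDerivAt_lamFun (hs n hn)).continuousAt.tendsto.comp (hpt n)).norm
      filter_upwards [h1.eventually_ne (hs n hn), h2.eventually_lt_const (lt_add_one _)] with p h h'
      exact fun _ ↦ ⟨h, h'⟩
    · simp [hn]
  have h1 : ∀ᶠ p : ℂ × ℂ in nhds (u₀, τ₀), τ₀.im / 2 < p.2.im := by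
    have : Continuous fun p : ℂ × ℂ ↦ p.2.im := by fun_prop
    exact (this.tendsto (u₀, τ₀)).eventually_const_lt (half_lt_self hτ)
  have h2 : ∀ᶠ p : ℂ × ℂ in nhds (u₀, τ₀), |p.1.im| < |u₀.im| + 1 := by
    have : Continuous fun p : ℂ × ℂ ↦ |p.1.im| := by fun_prop
    exact (this.tendsto (u₀, τ₀)).eventually_lt_const (lt_add_one _)
  refine ⟨2 + ∑ n ∈ Finset.Icc (-N : ℤ) N, (‖lamFun (u₀ + n * τ₀)‖ + 1), ?_⟩
  have hsum : 0 ≤ ∑ n ∈ Finset.Icc (-N : ℤ) N, (‖lamFun (u₀ + n * τ₀)‖ + 1) :=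
    Finset.sum_nonneg fun _ _ ↦ by positivity
  filter_upwards [hfin, h1, h2] with p hp hp2 hp1 n hn
  rw [abs_lt] at hp1
  have him : (p.1 + n * p.2).im = p.1.im + n * p.2.im := by simp
  rcases lt_or_ge (N : ℤ) n with h | h
  · have hn' : (N : ℝ) ≤ n := by exact_mod_cast h.le
    have h' : 1 ≤ (p.1 + n * p.2).im := by
      rw [him]
      nlinarith [mul_le_mul hn' hp2.le (by linarith) (le_trans N.cast_nonneg hn')]
    have := lamFun_bound_of_one_le_im h'
    exact ⟨this.1, this.2.trans (by linarith)⟩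
  rcases lt_or_ge n (-N : ℤ) with h' | h'
  · have hn' : (N : ℝ) ≤ -n := by
      have : (N : ℤ) ≤ -n := by omega
      exact_mod_cast this
    have h' : (p.1 + n * p.2).im ≤ -1 := by
      rw [him]
      nlinarith [mul_le_mul hn' hp2.le (by linarith) (le_trans N.cast_nonneg hn')]
    have := lamFun_bound_of_im_le h'
    exact ⟨this.1, this.2.trans (by linarith)⟩
  · have hmem := Finset.mem_Icc.mpr ⟨h', h⟩
    obtain ⟨h3, h4⟩ := hp n hmem hn
    have := Finset.single_le_sum (f := fun n : ℤ ↦ ‖lamFun (u₀ + n * τ₀)‖ + 1)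
      (fun _ _ ↦ by positivity) hmem
    exact ⟨h3, by linarith⟩

/-- The condition that `u` does not lie in the lattice `ℤτ + ℤ`. -/
def OffLattice (τ u : ℂ) : Prop := ∀ n : ℤ, expTwoPi (u + n * τ) ≠ 1

lemma OffLattice.eventually_prod {τ u : ℂ} (hτ : 0 < τ.im) (hu : OffLattice τ u) :
    ∀ᶠ p : ℂ × ℂ in nhds (u, τ), OffLattice p.2 p.1 := by
  obtain ⟨C, hC⟩ := eventually_lamFun_bound (s := Set.univ) hτ fun n _ ↦ hu n
  filter_upwards [hC] with p hp n using (hp n trivial).1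

lemma tendsto_prodMk_const (u τ : ℂ) : Tendsto (fun w : ℂ ↦ (w, τ)) (nhds u) (nhds (u, τ)) :=
  (Continuous.prodMk continuous_id continuous_const).tendsto u

lemma OffLattice.eventually {τ u : ℂ} (hτ : 0 < τ.im) (hu : OffLattice τ u) :
    ∀ᶠ w in nhds u, OffLattice τ w :=
  (tendsto_prodMk_const u τ).eventually (hu.eventually_prod hτ)

lemma eventually_expTwoPi_ne_one (u : ℂ) :
    ∀ᶠ w in nhdsWithin u {u}ᶜ, expTwoPi w ≠ 1 := by
  have := (hasDerivAt_expTwoPi u).eventually_ne (c := 1) (by simp [expTwoPi_ne_zero])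
  exact this

lemma eventually_offLattice {τ : ℂ} (hτ : 0 < τ.im) (u : ℂ) :
    ∀ᶠ w in nhdsWithin u {u}ᶜ, OffLattice τ w := by
  obtain ⟨C, hC⟩ := eventually_lamFun_bound (u₀ := u) (s := {n | expTwoPi (u + n * τ) ≠ 1}) hτ
    fun n hn ↦ hn
  have h1 := ((tendsto_prodMk_const u τ).eventually hC).filter_mono
    (nhdsWithin_le_nhds (s := {u}ᶜ))
  by_cases h : ∃ n : ℤ, expTwoPi (u + n * τ) = 1
  · obtain ⟨m, hm⟩ := h
    have ht : Tendsto (fun w ↦ w + m * τ) (nhdsWithin u {u}ᶜ)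
        (nhdsWithin (u + m * τ) {u + m * τ}ᶜ) := by
      refine tendsto_nhdsWithin_iff.mpr ⟨?_, ?_⟩
      · exact ((continuous_add_const _).tendsto u).mono_left nhdsWithin_le_nhds
      · filter_upwards [self_mem_nhdsWithin] with w hw
        simpa using hw
    filter_upwards [h1, ht.eventually (eventually_expTwoPi_ne_one _)] with w hw hw' n
    by_cases hn : expTwoPi (u + n * τ) = 1
    · have : expTwoPi (w + n * τ) = expTwoPi (w + m * τ) := by
        rw [expTwoPi_add] at hn hm ⊢
        rw [expTwoPi_add, mul_left_cancel₀ (expTwoPi_ne_zero u) (hn.trans hm.symm)]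
      rwa [this]
    · exact (hw n hn).1
  · push Not at h
    filter_upwards [h1] with w hw n using (hw n (h n)).1

lemma offLattice_add {τ u : ℂ} (hu : OffLattice τ u) (m n : ℤ) :
    OffLattice τ (u + (m * τ + n)) := by
  intro k
  have := hu (k + m)
  rwa [show u + (m * τ + n) + k * τ = u + (k + m : ℤ) * τ + n by push_cast; ring, expTwoPi_add _ n,
    expTwoPi_intCast, mul_one]

lemma exists_lattice_of_not_offLattice {τ u : ℂ} (hu : ¬ OffLattice τ u) :
    ∃ m n : ℤ, u = m * τ + n := by
  rw [OffLattice] at hu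
  push Not at hu
  obtain ⟨n, hn⟩ := hu
  obtain ⟨m, hm⟩ := expTwoPi_eq_one_iff.mp hn
  exact ⟨-n, m, by push_cast; linear_combination hm⟩

/-- A function that is holomorphic off the lattice, quasi-periodic up to a constant of modulus one,
and has no pole at the origin is constant. -/
theorem exists_eq_const_of_quasiperiodic {τ : ℂ} (hτ : 0 < τ.im) {f : ℂ → ℂ} {ε : ℂ}
    (hε : ‖ε‖ = 1) (hd : ∀ u, OffLattice τ u → DifferentiableAt ℂ f u)
    (h1 : ∀ u, OffLattice τ u → f (u + 1) = f u)
    (h2 : ∀ u, OffLattice τ u → f (u + τ) = ε * f u)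
    (h0 : Tendsto (fun u ↦ u * f u) (nhdsWithin 0 {0}ᶜ) (nhds 0)) :
    ∃ c, ∀ u, OffLattice τ u → f u = c := by
  have hε0 : ε ≠ 0 := by rintro rfl; simp at hε
  have h1n (u : ℂ) (hu : OffLattice τ u) (n : ℤ) : f (u + n) = f u := by
    induction n with
    | zero => simp
    | succ n ih =>
      have := h1 (u + n) (by simpa using offLattice_add hu 0 n)
      push_cast at ih ⊢
      rw [← add_assoc, this, ih]
    | pred n ih =>
      have := h1 (u + (-n - 1)) (by simpa using offLattice_add hu 0 (-n - 1))
      push_cast at ih ⊢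
      rw [← this, ← ih]; congr 1; ring
  have h2n (u : ℂ) (hu : OffLattice τ u) (n : ℤ) : f (u + n * τ) = ε ^ n * f u := by
    induction n with
    | zero => simp
    | succ n ih =>
      have := h2 (u + n * τ) (by simpa using offLattice_add hu n 0)
      push_cast at ih ⊢
      rw [show u + (n + 1) * τ = u + n * τ + τ by ring, this, ih, zpow_add_one₀ hε0]; ring
    | pred n ih =>
      have := h2 (u + (-n - 1) * τ) (by simpa using offLattice_add hu (-n - 1) 0)
      rw [show u + (-n - 1) * τ + τ = u + -n * τ by ring] at this
      push_cast at ih ⊢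
      rw [this] at ih
      rw [zpow_sub_one₀ hε0, mul_right_comm, ← ih]; field_simp
  have hmn (u : ℂ) (hu : OffLattice τ u) (m n : ℤ) : f (u + (m * τ + n)) = ε ^ m * f u := by
    rw [← add_assoc, h1n _ (by simpa using offLattice_add hu m 0), h2n _ hu]
  -- local holomorphic extensions
  have hloc (u : ℂ) : ∃ h : ℂ → ℂ, (∀ᶠ w in nhds u, DifferentiableAt ℂ h w) ∧
      ∀ᶠ w in nhdsWithin u {u}ᶜ, f w = h w := by
    by_cases hu : OffLattice τ u
    · exact ⟨f, (hu.eventually hτ).mono fun w hw ↦ hd w hw, Eventually.of_forall fun _ ↦ rfl⟩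
    obtain ⟨m, n, rfl⟩ := exists_lattice_of_not_offLattice hu
    have hoff := eventually_offLattice hτ 0
    have ho : (fun z ↦ f z - f 0) =o[nhdsWithin 0 {0}ᶜ] fun z ↦ (z - 0)⁻¹ := by
      rw [Asymptotics.isLittleO_iff_tendsto' ?_]
      · have hz : Tendsto (fun z : ℂ ↦ z * f 0) (nhdsWithin 0 {0}ᶜ) (nhds 0) := by
          have : Continuous fun z : ℂ ↦ z * f 0 := by fun_prop
          simpa using (this.tendsto 0).mono_left nhdsWithin_le_nhds
        refine (h0.sub hz).congr' ?_ |>.trans (by simp)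
        exact Eventually.of_forall fun z ↦ by simp; ring
      · filter_upwards [self_mem_nhdsWithin] with z hz h
        simp_all
    have hdiff := differentiableOn_update_limUnder_insert_of_isLittleO hoff
      (fun w hw ↦ (hd w hw).differentiableWithinAt) ho
    set g := Function.update f 0 (limUnder (nhdsWithin 0 {0}ᶜ) f) with hg
    have hmem : insert 0 {x | OffLattice τ x} ∈ nhds (0 : ℂ) := insert_mem_nhds_iff.mpr hoff
    have hgd : ∀ᶠ w in nhds (0 : ℂ), DifferentiableAt ℂ g w := by
      filter_upwards [eventually_mem_nhds_iff.mpr hmem] with w hw using hdiff.differentiableAt hw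
    have hsub : Tendsto (fun w : ℂ ↦ w - (m * τ + n)) (nhds (m * τ + n)) (nhds 0) := by
      have : Continuous fun w : ℂ ↦ w - (m * τ + n) := by fun_prop
      simpa using this.tendsto (m * τ + n)
    refine ⟨fun w ↦ ε ^ m * g (w - (m * τ + n)), ?_, ?_⟩
    · filter_upwards [hsub.eventually hgd] with w hw
      exact (hw.comp w (f := fun w : ℂ ↦ w - (m * τ + n)) (by fun_prop)).const_mul _
    · have hsub' : Tendsto (fun w : ℂ ↦ w - (m * τ + n)) (nhdsWithin (m * τ + n) {m * τ + n}ᶜ)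
          (nhdsWithin 0 {0}ᶜ) := by
        refine tendsto_nhdsWithin_iff.mpr ⟨hsub.mono_left nhdsWithin_le_nhds, ?_⟩
        filter_upwards [self_mem_nhdsWithin] with w hw
        simpa [sub_eq_zero] using hw
      filter_upwards [hsub'.eventually hoff, hsub'.eventually self_mem_nhdsWithin] with w hw hw0
      rw [hg, Function.update_of_ne (by simpa using hw0), ← hmn _ hw m n, sub_add_cancel]
  set g : ℂ → ℂ := fun u ↦ limUnder (nhdsWithin u {u}ᶜ) f with hg
  have hlim {u : ℂ} {h : ℂ → ℂ} (hh : ContinuousAt h u)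
      (hfh : ∀ᶠ w in nhdsWithin u {u}ᶜ, f w = h w) : g u = h u := by
    refine Tendsto.limUnder_eq ?_
    exact (hh.tendsto.mono_left nhdsWithin_le_nhds).congr' (hfh.mono fun _ h ↦ h.symm)
  have hgd : Differentiable ℂ g := by
    intro u
    obtain ⟨h, hh, hfh⟩ := hloc u
    refine hh.self_of_nhds.congr_of_eventuallyEq ?_
    have h3 := eventually_nhdsWithin_iff.mp
      (eventually_eventually_nhdsWithin (a := u) (s := {u}ᶜ).mpr hfh)
    filter_upwards [hh, h3] with w hw hw'
    rcases eq_or_ne w u with rfl | hne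
    · exact hlim hw.continuousAt hfh
    · refine hlim hw.continuousAt ?_
      have := hw' hne
      have hn : nhdsWithin w {u}ᶜ = nhds w := isOpen_compl_singleton.nhdsWithin_eq hne
      rw [hn] at this
      exact this.filter_mono nhdsWithin_le_nhds
  have hfg (u : ℂ) (hu : OffLattice τ u) : g u = f u :=
    hlim (hd u hu).continuousAt (Eventually.of_forall fun _ ↦ rfl)
  -- boundedness on a fundamental domain
  have hK : IsCompact ((fun p : ℝ × ℝ ↦ (p.1 * τ + p.2 : ℂ)) '' (Set.Icc 0 1 ×ˢ Set.Icc 0 1)) :=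
    (isCompact_Icc.prod isCompact_Icc).image (by fun_prop)
  obtain ⟨B, hB⟩ := hK.exists_bound_of_continuousOn hgd.continuous.continuousOn
  have hfB (u : ℂ) (hu : OffLattice τ u) : ‖f u‖ ≤ B := by
    set a : ℝ := u.im / τ.im
    set b : ℝ := u.re - a * τ.re
    have hab : u = a * τ + b := by
      apply Complex.ext
      · simp [b]
      · simp [a, hτ.ne']
    set v : ℂ := u + ((-⌊a⌋ : ℤ) * τ + (-⌊b⌋ : ℤ))
    have hv : OffLattice τ v := offLattice_add hu _ _
    have hvK : v = (Int.fract a : ℝ) * τ + (Int.fract b : ℝ) := by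
      simp only [v, Int.fract]
      push_cast
      rw [hab]; ring
    have hb := hB v ⟨(Int.fract a, Int.fract b), ⟨⟨Int.fract_nonneg _, (Int.fract_lt_one _).le⟩,
      ⟨Int.fract_nonneg _, (Int.fract_lt_one _).le⟩⟩, hvK.symm⟩
    rw [hfg v hv, hmn u hu, norm_mul, norm_zpow, hε, one_zpow, one_mul] at hb
    exact hb
  have hgB (u : ℂ) : ‖g u‖ ≤ B := by
    have ht : Tendsto g (nhdsWithin u {u}ᶜ) (nhds (g u)) :=
      (hgd u).continuousAt.tendsto.mono_left nhdsWithin_le_nhds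
    refine le_of_tendsto ht.norm ?_
    filter_upwards [eventually_offLattice hτ u] with w hw
    rw [hfg w hw]
    exact hfB w hw
  obtain ⟨c, hc⟩ := hgd.exists_const_forall_eq_of_bounded
    (isBounded_iff_forall_norm_le.mpr ⟨B, by rintro _ ⟨u, rfl⟩; exact hgB u⟩)
  exact ⟨c, fun u hu ↦ by rw [← hfg u hu, hc]⟩

lemma hasDerivAt_tsum_of_eventually_norm_le {ι : Type*} {F F' : ι → ℂ → ℂ} {b : ι → ℝ} {z : ℂ}
    (hb : Summable b)
    (h : ∀ᶠ w in nhds z, ∀ n, HasDerivAt (F n) (F' n w) w ∧ ‖F n w‖ ≤ b n) :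
    Summable (fun n ↦ F' n z) ∧ HasDerivAt (fun w ↦ ∑' n, F n w) (∑' n, F' n z) z := by
  obtain ⟨U, hU, hUo, hzU⟩ := eventually_nhds_iff.mp h
  have hd : ∀ n, DifferentiableOn ℂ (F n) U :=
    fun n w hw ↦ (hU w hw n).1.differentiableAt.differentiableWithinAt
  have hle : ∀ n, ∀ w ∈ U, ‖F n w‖ ≤ b n := fun n w hw ↦ (hU w hw n).2
  have h1 := hasSum_deriv_of_summable_norm hb hd hUo hle hzU
  have h2 := (differentiableOn_tsum_of_summable_norm hb hd hUo hle).differentiableAt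
    (hUo.mem_nhds hzU)
  simp_rw [fun n ↦ (hU z hzU n).1.deriv] at h1
  exact ⟨h1.summable, by rw [h1.tsum_eq]; exact h2.hasDerivAt⟩

lemma summable_norm_pow_mul_jacobiTheta₂_term (k : ℕ) (z : ℂ) {τ : ℂ} (hτ : 0 < τ.im) :
    Summable fun n : ℤ ↦ ‖(n : ℂ) ^ k * jacobiTheta₂_term n z τ‖ := by
  refine (summable_pow_mul_jacobiTheta₂_term_bound |z.im| hτ k).of_nonneg_of_le
    (fun _ ↦ norm_nonneg _) fun n ↦ ?_
  rw [norm_mul, norm_pow, norm_intCast, ← Int.cast_abs]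
  gcongr
  exact norm_jacobiTheta₂_term_le hτ le_rfl le_rfl n

/-- The sum `∑ cₙ λ(u + nτ)ᵏ`, where `λ(u) = ζ / (1 - ζ)`. -/
def lamSum (c : ℤ → ℂ) (k : ℕ) (τ u : ℂ) : ℂ := ∑' n : ℤ, c n * lamFun (u + n * τ) ^ k

lemma lamSum_aux {c : ℤ → ℂ} (hc : Summable fun n ↦ ‖c n‖) (k : ℕ) {τ u : ℂ} (hτ : 0 < τ.im)
    (hu : ∀ n, c n ≠ 0 → expTwoPi (u + n * τ) ≠ 1) :
    ∃ b : ℤ → ℝ, Summable b ∧ ∀ᶠ w in nhds u, ∀ n,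
      HasDerivAt (fun w ↦ c n * lamFun (w + n * τ) ^ k)
        (c n * (k * lamFun (w + n * τ) ^ (k - 1) *
          (2 * π * I * (lamFun (w + n * τ) + lamFun (w + n * τ) ^ 2)))) w ∧
      ‖c n * lamFun (w + n * τ) ^ k‖ ≤ b n := by
  obtain ⟨C, hC⟩ := eventually_lamFun_bound (s := {n | c n ≠ 0}) hτ hu
  refine ⟨fun n ↦ ‖c n‖ * C ^ k, hc.mul_right _, ?_⟩
  filter_upwards [(tendsto_prodMk_const u τ).eventually hC] with w hw n
  by_cases hn : c n = 0
  · simp only [hn, zero_mul, norm_zero, le_refl, and_true]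
    exact hasDerivAt_const _ _
  obtain ⟨h1, h2⟩ := hw n hn
  refine ⟨?_, ?_⟩
  · exact (((hasDerivAt_lamFun h1).comp_add_const w (n * τ)).pow k).const_mul (c n)
  · rw [norm_mul, norm_pow]
    gcongr

lemma summable_lamSum {c : ℤ → ℂ} (hc : Summable fun n ↦ ‖c n‖) (k : ℕ) {τ u : ℂ} (hτ : 0 < τ.im)
    (hu : ∀ n, c n ≠ 0 → expTwoPi (u + n * τ) ≠ 1) :
    Summable fun n : ℤ ↦ c n * lamFun (u + n * τ) ^ k := by
  obtain ⟨b, hb, h⟩ := lamSum_aux hc k hτ hu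
  exact hb.of_norm_bounded fun n ↦ (h.self_of_nhds n).2

lemma hasDerivAt_lamSum {c : ℤ → ℂ} (hc : Summable fun n ↦ ‖c n‖) {k : ℕ} (hk : k ≠ 0) {τ u : ℂ}
    (hτ : 0 < τ.im) (hu : ∀ n, c n ≠ 0 → expTwoPi (u + n * τ) ≠ 1) :
    HasDerivAt (lamSum c k τ) (2 * π * I * k * (lamSum c k τ u + lamSum c (k + 1) τ u)) u := by
  obtain ⟨b, hb, h⟩ := lamSum_aux hc k hτ hu
  have h1 := hasDerivAt_tsum_of_eventually_norm_le hb h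
  refine h1.2.congr_deriv ?_
  rw [lamSum, lamSum, ← (summable_lamSum hc k hτ hu).tsum_add (summable_lamSum hc _ hτ hu),
    ← tsum_mul_left]
  refine tsum_congr fun n ↦ ?_
  obtain ⟨k, rfl⟩ := Nat.exists_eq_succ_of_ne_zero hk
  simp only [Nat.succ_eq_add_one, Nat.add_sub_cancel]
  ring

lemma lamSum_add_one (c : ℤ → ℂ) (k : ℕ) (τ u : ℂ) : lamSum c k τ (u + 1) = lamSum c k τ u := by
  refine tsum_congr fun n ↦ ?_
  rw [add_right_comm, lamFun_add_one]

lemma tendsto_mul_lamFun : Tendsto (fun u ↦ u * lamFun u) (nhdsWithin 0 {0}ᶜ)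
    (nhds (-(2 * π * I)⁻¹)) := by
  have h := (tendsto_expTwoPi_sub_one_div.inv₀ two_pi_I_ne_zero).neg
  have h1 : Tendsto expTwoPi (nhdsWithin 0 {0}ᶜ) (nhds 1) := by
    have := (continuous_expTwoPi.tendsto 0).mono_left (nhdsWithin_le_nhds (s := {0}ᶜ))
    rwa [expTwoPi_zero] at this
  refine ((h1.mul h).congr fun u ↦ ?_).trans (by simp)
  rw [lamFun, mul_inv, inv_inv, ← neg_sub, inv_neg]
  ring

lemma tendsto_pow_mul_lamSum {c : ℤ → ℂ} (hc : Summable fun n ↦ ‖c n‖) {k : ℕ} (hk : k ≠ 0) {τ : ℂ}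
    (hτ : 0 < τ.im) :
    Tendsto (fun u ↦ u ^ k * lamSum c k τ u) (nhdsWithin 0 {0}ᶜ)
      (nhds (c 0 * (-(2 * π * I)⁻¹) ^ k)) := by
  set c' := Function.update c 0 0 with hc'
  have hc's : Summable fun n ↦ ‖c' n‖ := by
    refine hc.of_nonneg_of_le (fun _ ↦ norm_nonneg _) fun n ↦ ?_
    rcases eq_or_ne n 0 with rfl | hn
    · simp [hc']
    · simp [hc', hn]
  have hoff : ∀ n, c' n ≠ 0 → expTwoPi (0 + n * τ) ≠ 1 := by
    intro n hn h
    have hn0 : n ≠ 0 := by rintro rfl; simp [hc'] at hn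
    rw [zero_add] at h
    obtain ⟨m, hm⟩ := expTwoPi_eq_one_iff.mp h
    have := congrArg Complex.im hm
    simp at this
    rcases this with h | h
    · exact hn0 h
    · exact hτ.ne' h
  have h1 : Tendsto (fun u ↦ u ^ k * lamSum c' k τ u) (nhdsWithin 0 {0}ᶜ) (nhds 0) := by
    have := ((continuous_pow k).tendsto (0 : ℂ)).mul
      (hasDerivAt_lamSum hc's hk hτ hoff).continuousAt.tendsto
    rw [zero_pow hk, zero_mul] at this
    exact this.mono_left nhdsWithin_le_nhds
  have h2 := ((tendsto_mul_lamFun.pow k).const_mul (c 0)).add h1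
  rw [add_zero] at h2
  refine h2.congr' ?_
  filter_upwards [eventually_offLattice hτ 0] with u hu
  rw [lamSum, lamSum, (summable_lamSum hc k hτ fun n _ ↦ hu n).tsum_eq_add_tsum_ite 0, mul_add]
  congr 1
  · simp; ring
  · congr 1
    refine tsum_congr fun n ↦ ?_
    rcases eq_or_ne n 0 with rfl | hn
    · simp [hc']
    · simp [hc', hn]

/-- Summing against lower powers of the pole order kills the singularity. -/
lemma tendsto_pow_mul_lamSum_zero {c : ℤ → ℂ} (hc : Summable fun n ↦ ‖c n‖) {k j : ℕ} (hk : k ≠ 0)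
    (hj : k < j) {τ : ℂ} (hτ : 0 < τ.im) :
    Tendsto (fun u ↦ u ^ j * lamSum c k τ u) (nhdsWithin 0 {0}ᶜ) (nhds 0) := by
  have h1 : Tendsto (fun u : ℂ ↦ u ^ (j - k)) (nhdsWithin 0 {0}ᶜ) (nhds 0) := by
    have := (continuous_pow (j - k)).tendsto (0 : ℂ)
    rw [zero_pow (by omega)] at this
    exact this.mono_left nhdsWithin_le_nhds
  have := h1.mul (tendsto_pow_mul_lamSum hc hk hτ)
  rw [zero_mul] at this
  refine this.congr fun u ↦ ?_
  rw [← mul_assoc, ← pow_add]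
  congr 2; omega

/-- The Fourier coefficient `(-1)ⁿ q^{n²}` with `q = e^{2πiτ}`. -/
def altSq (τ : ℂ) (n : ℤ) : ℂ := jacobiTheta₂_term n (1 / 2) (2 * τ)

lemma summable_norm_pow_mul_altSq (k : ℕ) {τ : ℂ} (hτ : 0 < τ.im) :
    Summable fun n : ℤ ↦ ‖(n : ℂ) ^ k * altSq τ n‖ :=
  summable_norm_pow_mul_jacobiTheta₂_term k _ (by simpa using hτ)

lemma hasDerivAt_altSq (τ : ℂ) (n : ℤ) :
    HasDerivAt (fun t ↦ altSq t n) (2 * π * I * n ^ 2 * altSq τ n) τ := by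
  have h : HasDerivAt (fun t : ℂ ↦ 2 * π * I * n * (1 / 2) + π * I * n ^ 2 * (2 * t))
      (π * I * n ^ 2 * (2 * 1)) τ := (((hasDerivAt_id τ).const_mul 2).const_mul _).const_add _
  refine h.cexp.congr_deriv ?_
  rw [altSq, jacobiTheta₂_term]; ring

lemma eventually_norm_altSq_le {τ : ℂ} (hτ : 0 < τ.im) :
    ∃ b : ℤ → ℝ, Summable b ∧ ∀ᶠ t in nhds τ, ∀ n, ‖altSq t n‖ ≤ b n := by
  refine ⟨_, summable_pow_mul_jacobiTheta₂_term_bound 0 hτ 0, ?_⟩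
  have h : Continuous fun t : ℂ ↦ (2 * t).im := by fun_prop
  have h' : τ.im < (2 * τ).im := by simp; linarith
  filter_upwards [(h.tendsto τ).eventually_const_lt h'] with t ht n
  rw [pow_zero, one_mul]
  exact norm_jacobiTheta₂_term_le hτ (by simp) ht.le n

lemma hasDerivAt_tsum_altSq {τ : ℂ} (hτ : 0 < τ.im) :
    HasDerivAt (fun t ↦ ∑' n, altSq t n) (2 * π * I * ∑' n : ℤ, (n : ℂ) ^ 2 * altSq τ n) τ := by
  obtain ⟨b, hb, h⟩ := eventually_norm_altSq_le hτ
  refine (hasDerivAt_tsum_of_eventually_norm_le hb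
    (h.mono fun t ht n ↦ ⟨hasDerivAt_altSq t n, ht n⟩)).2.congr_deriv ?_
  rw [← tsum_mul_left]
  exact tsum_congr fun n ↦ by ring

/-- The sum `∑ (-1)ⁿ nʲ q^{n²} λ(u + nτ)ᵏ`. -/
def altLamSum (j k : ℕ) (τ u : ℂ) : ℂ := lamSum (fun n ↦ (n : ℂ) ^ j * altSq τ n) k τ u

lemma hasSum_altLamSum (j k : ℕ) {τ u : ℂ} (hτ : 0 < τ.im) (hu : OffLattice τ u) :
    HasSum (fun n : ℤ ↦ (n : ℂ) ^ j * altSq τ n * lamFun (u + n * τ) ^ k) (altLamSum j k τ u) :=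
  (summable_lamSum (summable_norm_pow_mul_altSq j hτ) k hτ fun n _ ↦ hu n).hasSum

lemma hasDerivAt_altLamSum (j : ℕ) {k : ℕ} (hk : k ≠ 0) {τ u : ℂ} (hτ : 0 < τ.im)
    (hu : OffLattice τ u) :
    HasDerivAt (altLamSum j k τ)
      (2 * π * I * k * (altLamSum j k τ u + altLamSum j (k + 1) τ u)) u :=
  hasDerivAt_lamSum (summable_norm_pow_mul_altSq j hτ) hk hτ fun n _ ↦ hu n

lemma altLamSum_add_one (j k : ℕ) (τ u : ℂ) : altLamSum j k τ (u + 1) = altLamSum j k τ u :=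
  lamSum_add_one _ k τ u

lemma hasDerivAt_altLamSum_snd {τ u : ℂ} (hτ : 0 < τ.im) (hu : OffLattice τ u) :
    HasDerivAt (fun t ↦ altLamSum 0 1 t u)
      (2 * π * I * (altLamSum 2 1 τ u + altLamSum 1 1 τ u + altLamSum 1 2 τ u)) τ := by
  obtain ⟨b, hb, h⟩ := eventually_norm_altSq_le hτ
  obtain ⟨C, hC⟩ := eventually_lamFun_bound (s := Set.univ) hτ fun n _ ↦ hu n
  have hC' := ((Continuous.prodMk continuous_const continuous_id).tendsto τ).eventually hC
  have hF : ∀ᶠ t in nhds τ, ∀ n : ℤ, HasDerivAt (fun t ↦ altSq t n * lamFun (u + n * t) ^ 1)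
      (2 * π * I * n ^ 2 * altSq t n * lamFun (u + n * t) + altSq t n *
        (2 * π * I * (lamFun (u + n * t) + lamFun (u + n * t) ^ 2) * n)) t ∧
      ‖altSq t n * lamFun (u + n * t) ^ 1‖ ≤ b n * C := by
    filter_upwards [h, hC'] with t ht ht' n
    obtain ⟨h1, h2⟩ := ht' n trivial
    simp only [pow_one, id] at h1 h2 ⊢
    refine ⟨?_, ?_⟩
    · refine (hasDerivAt_altSq t n).mul ?_
      have hl : HasDerivAt (fun t : ℂ ↦ u + n * t) n t := by
        simpa using ((hasDerivAt_id t).const_mul (n : ℂ)).const_add u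
      exact (hasDerivAt_lamFun h1).comp t hl
    · rw [norm_mul]
      exact mul_le_mul (ht n) h2 (norm_nonneg _) ((norm_nonneg _).trans (ht n))
  have h0 : (fun t ↦ altLamSum 0 1 t u) = fun t ↦ ∑' n : ℤ, altSq t n * lamFun (u + n * t) ^ 1 := by
    simp [altLamSum, lamSum]
  rw [h0]
  refine (hasDerivAt_tsum_of_eventually_norm_le (hb.mul_right C) hF).2.congr_deriv ?_
  refine HasSum.tsum_eq ?_
  convert! (((hasSum_altLamSum 2 1 hτ hu).add (hasSum_altLamSum 1 1 hτ hu)).add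
    (hasSum_altLamSum 1 2 hτ hu)).mul_left (2 * π * I) using 2 with n
  ring

lemma tsum_eq_zero_of_one_sub {f : ℤ → ℂ} (h : ∀ n, f (1 - n) = -f n) : ∑' n, f n = 0 := by
  have h1 := (Equiv.subLeft (1 : ℤ)).tsum_eq f
  simp only [Equiv.subLeft_apply, h, tsum_neg] at h1
  exact self_eq_neg.mp h1.symm

lemma lamSum_add_tau (c : ℤ → ℂ) (k : ℕ) (τ u : ℂ) :
    lamSum c k τ (u + τ) = ∑' n : ℤ, c (n - 1) * lamFun (u + n * τ) ^ k := by
  rw [← (Equiv.addRight (1 : ℤ)).tsum_eq, lamSum]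
  refine tsum_congr fun n ↦ ?_
  simp only [Equiv.coe_addRight, add_sub_cancel_right]
  push_cast
  ring_nf

lemma lamFun_eq_of_ne_one {u : ℂ} (hu : expTwoPi u ≠ 1) :
    lamFun u = expTwoPi u * (1 + lamFun u) := by
  have : 1 - expTwoPi u ≠ 0 := sub_ne_zero.mpr hu.symm
  rw [lamFun]
  field_simp
  ring

/-- The coefficient `(-1)ⁿ q^{n(n-1)/2}` with `q = e^{2πiτ}`. -/
def altTri (τ : ℂ) (n : ℤ) : ℂ := jacobiTheta₂_term n (1 / 2 - τ / 2) τ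

lemma summable_norm_altTri {τ : ℂ} (hτ : 0 < τ.im) : Summable fun n ↦ ‖altTri τ n‖ := by
  have := summable_norm_pow_mul_jacobiTheta₂_term 0 (1 / 2 - τ / 2) hτ
  simp only [pow_zero, one_mul] at this
  exact this

lemma altTri_one_sub (τ : ℂ) (n : ℤ) : altTri τ (1 - n) = -altTri τ n := by
  rw [altTri, altTri, jacobiTheta₂_term, jacobiTheta₂_term, ← Complex.exp_add_pi_mul_I,
    Complex.exp_eq_exp_iff_exists_int]
  exact ⟨-n, by push_cast; ring⟩

lemma altTri_sub_one (τ u : ℂ) (n : ℤ) :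
    altTri τ (n - 1) =
      -(expTwoPi τ * expTwoPi u) * (altTri τ n * (expTwoPi (u + n * τ))⁻¹) := by
  rw [altTri, altTri, jacobiTheta₂_term, jacobiTheta₂_term, expTwoPi, expTwoPi, expTwoPi,
    ← Complex.exp_neg, ← Complex.exp_add, neg_mul, ← Complex.exp_add, ← Complex.exp_add,
    ← Complex.exp_add_pi_mul_I, Complex.exp_eq_exp_iff_exists_int]
  exact ⟨-1, by push_cast; ring⟩

lemma lamSum_altTri_add_tau {τ u : ℂ} (hτ : 0 < τ.im) (hu : OffLattice τ u) :
    lamSum (altTri τ) 1 τ (u + τ) =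
      -(expTwoPi τ * expTwoPi u) * lamSum (altTri τ) 1 τ u := by
  have h0 : HasSum (altTri τ) 0 := by
    rw [← tsum_eq_zero_of_one_sub (altTri_one_sub τ)]
    exact (summable_norm_altTri hτ).of_norm.hasSum
  have h1 := (summable_lamSum (summable_norm_altTri hτ) 1 hτ fun n _ ↦ hu n).hasSum
  rw [lamSum_add_tau, lamSum]
  refine HasSum.tsum_eq ?_
  rw [← add_zero (∑' n : ℤ, _)]
  convert! (h1.add h0).mul_left (-(expTwoPi τ * expTwoPi u)) using 2 with n
  rw [altTri_sub_one τ u, pow_one, lamFun_eq_of_ne_one (hu n)]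
  have := expTwoPi_ne_zero (u + n * τ)
  rw [← lamFun_eq_of_ne_one (hu n)]
  nth_rewrite 1 [lamFun_eq_of_ne_one (hu n)]
  field_simp
  ring

/-- The partial fraction expansion of the reciprocal theta function. -/
theorem jTheta_mul_lamSum_altTri {τ u : ℂ} (hτ : 0 < τ.im) (hu : OffLattice τ u) :
    jTheta u τ * (cexp (-(π * I * u)) * lamSum (altTri τ) 1 τ u) = -I * dedekindEta τ ^ 3 := by
  set K : ℂ → ℂ := fun u ↦ jTheta u τ * (cexp (-(π * I * u)) * lamSum (altTri τ) 1 τ u) with hK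
  have hlim : Tendsto K (nhdsWithin 0 {0}ᶜ) (nhds (-I * dedekindEta τ ^ 3)) := by
    have h1 : Tendsto (fun u : ℂ ↦ cexp (-(π * I * u))) (nhdsWithin 0 {0}ᶜ) (nhds 1) := by
      have : Continuous fun u : ℂ ↦ cexp (-(π * I * u)) := by fun_prop
      simpa using (this.tendsto 0).mono_left nhdsWithin_le_nhds
    have h2 := tendsto_pow_mul_lamSum (summable_norm_altTri hτ) one_ne_zero hτ
    have h3 := (tendsto_jTheta_div hτ).mul (h1.mul h2)
    have hc : altTri τ 0 = 1 := by simp [altTri, jacobiTheta₂_term]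
    have he : -2 * π * dedekindEta τ ^ 3 * (1 * (altTri τ 0 * (-(2 * π * I)⁻¹) ^ 1)) =
        -I * dedekindEta τ ^ 3 := by
      have : (π : ℂ) ≠ 0 := by exact_mod_cast Real.pi_ne_zero
      rw [hc]
      field_simp
      linear_combination dedekindEta τ ^ 3 * I_sq
    rw [he] at h3
    refine h3.congr' ?_
    filter_upwards [self_mem_nhdsWithin] with u hu
    have : u ≠ 0 := hu
    rw [hK]
    field_simp
  have hper : ∃ c, ∀ u, OffLattice τ u → K u = c := by
    refine exists_eq_const_of_quasiperiodic (ε := 1) hτ norm_one ?_ ?_ ?_ ?_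
    · intro u hu
      have h1 := (hasDerivAt_lamSum (summable_norm_altTri hτ) one_ne_zero hτ
        fun n _ ↦ hu n).differentiableAt
      have h2 := differentiable_jTheta hτ u
      exact h2.mul ((by fun_prop : DifferentiableAt ℂ (fun u : ℂ ↦ cexp (-(π * I * u))) u).mul h1)
    · intro u hu
      simp only [hK]
      rw [jTheta_add_one, lamSum_add_one, show -(π * I * (u + 1)) = -(π * I * u) - π * I by ring,
        Complex.exp_sub_pi_mul_I]
      ring
    · intro u hu
      simp only [hK]
      rw [jTheta_add_tau, lamSum_altTri_add_tau hτ hu]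
      have h1 : cexp (-(π * I * (u + τ))) = cexp (-(π * I * u)) * cexp (-π * I * τ) := by
        rw [← Complex.exp_add]; ring_nf
      have h2 : cexp (-π * I * τ) ^ 2 * expTwoPi τ = 1 := by
        rw [expTwoPi, ← Complex.exp_nat_mul, ← Complex.exp_add, ← Complex.exp_zero]
        congr 1; push_cast; ring
      have h3 := inv_mul_cancel₀ (expTwoPi_ne_zero u)
      rw [h1]
      generalize cexp (-π * I * τ) = E at *
      linear_combination (jTheta u τ * cexp (-(π * I * u)) * lamSum (altTri τ) 1 τ u) *
        (h2 + E ^ 2 * expTwoPi τ * h3)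
    · have h4 : Tendsto (fun u : ℂ ↦ u) (nhdsWithin 0 {0}ᶜ) (nhds 0) := nhdsWithin_le_nhds
      simpa using h4.mul hlim
  obtain ⟨c, hc⟩ := hper
  rw [← tendsto_nhds_unique hlim (tendsto_const_nhds.congr' ((eventually_offLattice hτ 0).mono
    fun w hw ↦ (hc w hw).symm))] at hc
  exact hc u hu

/-- The theta constant `∑ (-1)ⁿ q^{n²}` with `q = e^{2πiτ}`. -/
def altTheta (τ : ℂ) : ℂ := ∑' n, altSq τ n

lemma altTheta_mul_eta {τ : ℂ} (hτ : 0 < τ.im) :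
    altTheta τ * dedekindEta (2 * τ) = dedekindEta τ ^ 2 :=
  theta_four_mul_eta hτ

lemma two_mul_im_pos {τ : ℂ} (hτ : 0 < τ.im) : 0 < (2 * τ).im := by simpa using hτ

lemma altTheta_ne_zero {τ : ℂ} (hτ : 0 < τ.im) : altTheta τ ≠ 0 := by
  intro h
  have := altTheta_mul_eta hτ
  rw [h, zero_mul] at this
  exact pow_ne_zero 2 (dedekindEta_ne_zero hτ) this.symm

lemma expTwoPi_two_mul (u : ℂ) : expTwoPi (2 * u) = expTwoPi u ^ 2 := by
  rw [two_mul, expTwoPi_add, sq]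

lemma offLattice_of_two_mul {τ u : ℂ} (hu : OffLattice (2 * τ) (2 * u)) : OffLattice τ u := by
  intro n h
  refine hu n ?_
  rw [show 2 * u + n * (2 * τ) = 2 * (u + n * τ) by ring, expTwoPi_two_mul, h, one_pow]

lemma jTheta_self_two_mul (τ : ℂ) :
    jTheta τ (2 * τ) = -I * cexp (-π * I * τ / 2) * altTheta τ := by
  rw [jTheta_eq_jacobiTheta₂, show τ + 1 / 2 + 2 * τ / 2 = 1 / 2 + 2 * τ by ring,
    jacobiTheta₂_add_left', ← mul_assoc, ← Complex.exp_add]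
  have : (-I : ℂ) = cexp (-(π / 2 * I)) := by
    rw [Complex.exp_neg, Complex.exp_pi_div_two_mul_I, inv_I]
  rw [this, ← Complex.exp_add]
  congr 2
  ring

/-- The reciprocal theta function at doubled arguments, as a sum over odd powers. -/
lemma inv_jTheta_two_mul {τ u : ℂ} (hτ : 0 < τ.im) (hu : OffLattice (2 * τ) (2 * u)) :
    HasSum (fun n : ℤ ↦ altSq τ n *
        (expTwoPi (u + n * τ) / (1 - expTwoPi (u + n * τ) ^ 2)))
      (-I * dedekindEta (2 * τ) ^ 3 / jTheta (2 * u) (2 * τ)) := by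
  have hτ2 := two_mul_im_pos hτ
  have h := (summable_lamSum (summable_norm_altTri hτ2) 1 hτ2 fun n _ ↦ hu n).hasSum.mul_left
    (cexp (-(π * I * (2 * u))))
  rw [← jTheta_mul_lamSum_altTri hτ2 hu, mul_div_cancel_left₀ _ (jTheta_ne_zero hτ2 hu)]
  convert! h using 2 with n
  have h1 : cexp (-(π * I * (2 * u))) * altTri (2 * τ) n =
      altSq τ n * (expTwoPi (u + n * τ))⁻¹ := by
    rw [altTri, altSq, jacobiTheta₂_term, jacobiTheta₂_term, expTwoPi, ← Complex.exp_neg,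
      ← Complex.exp_add, ← Complex.exp_add]
    congr 1; ring
  rw [← mul_assoc, h1, lamFun, show 2 * u + n * (2 * τ) = 2 * (u + n * τ) by ring,
    expTwoPi_two_mul]
  have := expTwoPi_ne_zero (u + n * τ)
  field_simp

/-- The Appell–Lerch part as a sum over even powers. -/
lemma lerchMu_two_mul (τ u : ℂ) :
    cexp (-π * I * τ / 2) * cexp (2 * π * I * u) * lerchMu (2 * u) τ (2 * τ) =
      I / altTheta τ * ∑' n : ℤ, altSq τ n *
        (expTwoPi (u + n * τ) ^ 2 / (1 - expTwoPi (u + n * τ) ^ 2)) := by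
  have h : ∑' n : ℤ, (-1 : ℂ) ^ n *
      cexp (π * I * ((n : ℂ) ^ 2 + (n : ℂ)) * (2 * τ) + 2 * π * I * τ * (n : ℂ)) /
        (1 - cexp (2 * π * I * (n : ℂ) * (2 * τ) + 2 * π * I * (2 * u))) =
      (expTwoPi u ^ 2)⁻¹ * ∑' n : ℤ, altSq τ n *
        (expTwoPi (u + n * τ) ^ 2 / (1 - expTwoPi (u + n * τ) ^ 2)) := by
    rw [← tsum_mul_left]
    refine tsum_congr fun n ↦ ?_
    have h1 : (-1 : ℂ) ^ n *
        cexp (π * I * ((n : ℂ) ^ 2 + (n : ℂ)) * (2 * τ) + 2 * π * I * τ * (n : ℂ)) =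
        (expTwoPi u ^ 2)⁻¹ * (altSq τ n * expTwoPi (u + n * τ) ^ 2) := by
      rw [← Complex.exp_pi_mul_I, ← Complex.exp_int_mul, altSq, jacobiTheta₂_term, expTwoPi,
        expTwoPi, ← Complex.exp_nat_mul, ← Complex.exp_nat_mul, ← Complex.exp_neg,
        ← Complex.exp_add, ← Complex.exp_add, ← Complex.exp_add]
      congr 1; push_cast; ring
    have h2 : cexp (2 * π * I * (n : ℂ) * (2 * τ) + 2 * π * I * (2 * u)) =
        expTwoPi (u + n * τ) ^ 2 := by
      rw [expTwoPi, ← Complex.exp_nat_mul]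
      congr 1; push_cast; ring
    rw [h1, h2]; ring
  have h3 : cexp (2 * π * I * u) = expTwoPi u := rfl
  have h4 : cexp (π * I * (2 * u)) = expTwoPi u := by rw [expTwoPi]; congr 1; ring
  rw [lerchMu, h, jTheta_self_two_mul, h3, h4]
  have h5 := expTwoPi_ne_zero u
  have h6 := Complex.exp_ne_zero (-π * I * τ / 2)
  generalize cexp (-π * I * τ / 2) = E at *
  generalize ∑' n : ℤ, altSq τ n * _ = L at *
  by_cases h7 : altTheta τ = 0
  · simp [h7]
  field_simp
  rw [I_sq]; ring

/-- The bracketed function is a multiple of a single Lambert-type series. -/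
theorem bracket_eq {τ u : ℂ} (hτ : 0 < τ.im) (hu : OffLattice (2 * τ) (2 * u)) :
    dedekindEta (2 * τ) ^ 4 / (dedekindEta τ ^ 2 * jTheta (2 * u) (2 * τ)) +
      cexp (-π * I * τ / 2) * cexp (2 * π * I * u) * lerchMu (2 * u) τ (2 * τ) =
    I / altTheta τ * altLamSum 0 1 τ u := by
  have hτ2 := two_mul_im_pos hτ
  have hoff := offLattice_of_two_mul hu
  have h1 := inv_jTheta_two_mul hτ hu
  have h2 := (hasSum_altLamSum 0 1 hτ hoff).sub h1
  have h3 : ∑' n : ℤ, altSq τ n *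
      (expTwoPi (u + n * τ) ^ 2 / (1 - expTwoPi (u + n * τ) ^ 2)) =
      altLamSum 0 1 τ u - -I * dedekindEta (2 * τ) ^ 3 / jTheta (2 * u) (2 * τ) := by
    rw [← h2.tsum_eq]
    refine tsum_congr fun n ↦ ?_
    have h5 : 1 - expTwoPi (u + n * τ) ^ 2 ≠ 0 := by
      have := hu n
      rw [show 2 * u + n * (2 * τ) = 2 * (u + n * τ) by ring, expTwoPi_two_mul] at this
      exact sub_ne_zero.mpr this.symm
    have h6 : 1 - expTwoPi (u + n * τ) ≠ 0 := sub_ne_zero.mpr (hoff n).symm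
    rw [lamFun, pow_zero, one_mul, pow_one, ← mul_sub]
    congr 1
    rw [div_sub_div _ _ h6 h5, div_eq_div_iff h5 (mul_ne_zero h6 h5)]
    ring
  rw [lerchMu_two_mul, h3, ← altTheta_mul_eta hτ]
  have h7 := dedekindEta_ne_zero hτ2
  have h8 := altTheta_ne_zero hτ
  have h9 := jTheta_ne_zero hτ2 hu
  field_simp
  linear_combination dedekindEta (2 * τ) ^ 3 * I_sq

/-- The theta constant `∑ (-1)ⁿ n² q^{n²}`. -/
def altThetaSq (τ : ℂ) : ℂ := ∑' n : ℤ, (n : ℂ) ^ 2 * altSq τ n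

/-- The sum obtained by applying the heat operator to `∑ (-1)ⁿ q^{n²} λ(u + nτ)`. -/
def heatSum (τ u : ℂ) : ℂ :=
  4 * altLamSum 2 1 τ u + 4 * altLamSum 1 1 τ u + altLamSum 0 1 τ u + 4 * altLamSum 1 2 τ u +
    3 * altLamSum 0 2 τ u + 2 * altLamSum 0 3 τ u

lemma summable_altSq {τ : ℂ} (hτ : 0 < τ.im) (j : ℕ) :
    Summable fun n : ℤ ↦ (n : ℂ) ^ j * altSq τ n :=
  (summable_norm_pow_mul_altSq j hτ).of_norm

lemma altSq_sub_one (τ u : ℂ) (n : ℤ) :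
    altSq τ (n - 1) =
      -(expTwoPi τ * expTwoPi u ^ 2) * (altSq τ n * (expTwoPi (u + n * τ))⁻¹ ^ 2) := by
  rw [altSq, altSq, jacobiTheta₂_term, jacobiTheta₂_term, expTwoPi, expTwoPi, expTwoPi,
    ← Complex.exp_neg, ← Complex.exp_nat_mul, ← Complex.exp_nat_mul, ← Complex.exp_add, neg_mul,
    ← Complex.exp_add, ← Complex.exp_add, ← Complex.exp_add_pi_mul_I,
    Complex.exp_eq_exp_iff_exists_int]
  exact ⟨-1, by push_cast; ring⟩

/-- The coefficient `(-1)ⁿ q^{n² - n}`. -/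
def altPronic (τ : ℂ) (n : ℤ) : ℂ := jacobiTheta₂_term n (1 / 2 - τ) (2 * τ)

lemma altPronic_one_sub (τ : ℂ) (n : ℤ) : altPronic τ (1 - n) = -altPronic τ n := by
  rw [altPronic, altPronic, jacobiTheta₂_term, jacobiTheta₂_term, ← Complex.exp_add_pi_mul_I,
    Complex.exp_eq_exp_iff_exists_int]
  exact ⟨-n, by push_cast; ring⟩

lemma altSq_mul_inv (τ u : ℂ) (n : ℤ) :
    altSq τ n * (expTwoPi (u + n * τ))⁻¹ = (expTwoPi u)⁻¹ * altPronic τ n := by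
  rw [altSq, altPronic, jacobiTheta₂_term, jacobiTheta₂_term, expTwoPi, expTwoPi,
    ← Complex.exp_neg, ← Complex.exp_neg, ← Complex.exp_add, ← Complex.exp_add]
  congr 1; ring

lemma summable_altPronic {τ : ℂ} (hτ : 0 < τ.im) (j : ℕ) :
    Summable fun n : ℤ ↦ (n : ℂ) ^ j * altPronic τ n :=
  (summable_norm_pow_mul_jacobiTheta₂_term j _ (two_mul_im_pos hτ)).of_norm

lemma hasSum_altSq_mul_inv {τ : ℂ} (hτ : 0 < τ.im) (u : ℂ) :
    HasSum (fun n : ℤ ↦ altSq τ n * (expTwoPi (u + n * τ))⁻¹) 0 := by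
  simp_rw [altSq_mul_inv]
  rw [← mul_zero (expTwoPi u)⁻¹, ← tsum_eq_zero_of_one_sub (altPronic_one_sub τ)]
  refine HasSum.mul_left _ (Summable.hasSum ?_)
  simpa only [pow_zero, one_mul] using summable_altPronic hτ 0

lemma hasSum_sq_mul_altSq_mul_inv {τ : ℂ} (hτ : 0 < τ.im) (u : ℂ) :
    HasSum (fun n : ℤ ↦ (2 * n - 1) ^ 2 * (altSq τ n * (expTwoPi (u + n * τ))⁻¹)) 0 := by
  have h0 : ∑' n : ℤ, (2 * (n : ℂ) - 1) ^ 2 * altPronic τ n = 0 := by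
    refine tsum_eq_zero_of_one_sub fun n ↦ ?_
    rw [altPronic_one_sub]; push_cast; ring
  have h1 : Summable fun n : ℤ ↦ (2 * (n : ℂ) - 1) ^ 2 * altPronic τ n := by
    refine ((((summable_altPronic hτ 2).mul_left 4).sub ((summable_altPronic hτ 1).mul_left 4)).add
      (summable_altPronic hτ 0)).congr fun n ↦ ?_
    ring
  have h2 := h1.hasSum.mul_left (expTwoPi u)⁻¹
  rw [h0, mul_zero] at h2
  convert! h2 using 2 with n
  rw [altSq_mul_inv]; ring

lemma altLamSum_zero_one_add_tau {τ u : ℂ} (hτ : 0 < τ.im) (hu : OffLattice τ u) :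
    altLamSum 0 1 τ (u + τ) =
      -(expTwoPi τ * expTwoPi u ^ 2) * (altLamSum 0 1 τ u + altTheta τ) := by
  rw [altLamSum, lamSum_add_tau]
  have h1 : HasSum (altSq τ) (altTheta τ) := by
    have := (summable_altSq hτ 0).hasSum
    simp only [pow_zero, one_mul] at this
    exact this
  refine HasSum.tsum_eq ?_
  rw [← zero_add (altLamSum 0 1 τ u)]
  convert! (((hasSum_altSq_mul_inv hτ u).add (hasSum_altLamSum 0 1 hτ hu)).add h1).mul_left
    (-(expTwoPi τ * expTwoPi u ^ 2)) using 2 with n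
  rw [altSq_sub_one τ u, lamFun]
  have h2 := expTwoPi_ne_zero (u + n * τ)
  have h3 : 1 - expTwoPi (u + n * τ) ≠ 0 := sub_ne_zero.mpr (hu n).symm
  generalize expTwoPi (u + n * τ) = x at *
  field_simp
  ring

lemma hasSum_heatSum {τ u : ℂ} (hτ : 0 < τ.im) (hu : OffLattice τ u) :
    HasSum (fun n : ℤ ↦ altSq τ n * ((2 * n + 1) ^ 2 * lamFun (u + n * τ) +
      (4 * n + 3) * lamFun (u + n * τ) ^ 2 + 2 * lamFun (u + n * τ) ^ 3)) (heatSum τ u) := by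
  have h (j k : ℕ) := hasSum_altLamSum j k hτ hu
  rw [heatSum]
  convert! ((((((h 2 1).mul_left 4).add ((h 1 1).mul_left 4)).add (h 0 1)).add
    ((h 1 2).mul_left 4)).add ((h 0 2).mul_left 3)).add ((h 0 3).mul_left 2) using 2 with n
  ring

lemma offLattice_add_tau {τ u : ℂ} (hu : OffLattice τ u) : OffLattice τ (u + τ) := by
  simpa using offLattice_add hu 1 0

lemma heatSum_add_tau {τ u : ℂ} (hτ : 0 < τ.im) (hu : OffLattice τ u) :
    heatSum τ (u + τ) =
      -(expTwoPi τ * expTwoPi u ^ 2) * (heatSum τ u + 4 * altThetaSq τ) := by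
  rw [← (hasSum_heatSum hτ (offLattice_add_tau hu)).tsum_eq,
    ← (Equiv.subRight (1 : ℤ)).tsum_eq]
  refine HasSum.tsum_eq ?_
  rw [← zero_add (heatSum τ u)]
  convert! (((hasSum_sq_mul_altSq_mul_inv hτ u).add (hasSum_heatSum hτ hu)).add
    ((summable_altSq hτ 2).hasSum.mul_left 4)).mul_left
    (-(expTwoPi τ * expTwoPi u ^ 2)) using 2 with n
  rw [Equiv.subRight_apply, altSq_sub_one τ u,
    show u + τ + (n - 1 : ℤ) * τ = u + n * τ by push_cast; ring, lamFun]
  have h2 := expTwoPi_ne_zero (u + n * τ)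
  have h3 : 1 - expTwoPi (u + n * τ) ≠ 0 := sub_ne_zero.mpr (hu n).symm
  generalize expTwoPi (u + n * τ) = x at *
  push_cast
  field_simp
  ring

lemma heatSum_add_one (τ u : ℂ) : heatSum τ (u + 1) = heatSum τ u := by
  simp only [heatSum, altLamSum_add_one]

lemma differentiableAt_heatSum {τ u : ℂ} (hτ : 0 < τ.im) (hu : OffLattice τ u) :
    DifferentiableAt ℂ (heatSum τ) u := by
  have h (j : ℕ) {k : ℕ} (hk : k ≠ 0) : DifferentiableAt ℂ (altLamSum j k τ) u :=
    (hasDerivAt_altLamSum j hk hτ hu).differentiableAt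
  have h21 := h 2 one_ne_zero
  have h11 := h 1 one_ne_zero
  have h01 := h 0 one_ne_zero
  have h12 := h 1 two_ne_zero
  have h02 := h 0 two_ne_zero
  have h03 := h 0 three_ne_zero
  unfold heatSum
  fun_prop

lemma tendsto_cube_mul_heatSum {τ : ℂ} (hτ : 0 < τ.im) :
    Tendsto (fun u ↦ u ^ 3 * heatSum τ u) (nhdsWithin 0 {0}ᶜ)
      (nhds (2 * (-(2 * π * I)⁻¹) ^ 3)) := by
  have h (j : ℕ) {k : ℕ} (hk : k ≠ 0) (hk3 : k < 3) :
      Tendsto (fun u ↦ u ^ 3 * altLamSum j k τ u) (nhdsWithin 0 {0}ᶜ) (nhds 0) :=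
    tendsto_pow_mul_lamSum_zero (summable_norm_pow_mul_altSq j hτ) hk hk3 hτ
  have h3 := tendsto_pow_mul_lamSum (summable_norm_pow_mul_altSq 0 hτ) three_ne_zero hτ
  have hsum := ((((((h 2 one_ne_zero (by norm_num)).const_mul 4).add
    ((h 1 one_ne_zero (by norm_num)).const_mul 4)).add (h 0 one_ne_zero (by norm_num))).add
    ((h 1 two_ne_zero (by norm_num)).const_mul 4)).add
    ((h 0 two_ne_zero (by norm_num)).const_mul 3)).add (h3.const_mul 2)
  have hc : altSq τ 0 = 1 := by simp [altSq, jacobiTheta₂_term]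
  have he : (4 * 0 + 4 * 0 + 0 + 4 * 0 + 3 * 0 +
      2 * (((0 : ℤ) : ℂ) ^ 0 * altSq τ 0 * (-(2 * π * I)⁻¹) ^ 3) : ℂ) =
      2 * (-(2 * π * I)⁻¹) ^ 3 := by
    rw [hc]; ring
  rw [he] at hsum
  refine hsum.congr fun u ↦ ?_
  rw [heatSum, altLamSum.eq_def 0 3]
  ring

lemma tendsto_cube_mul_altLamSum {τ : ℂ} (hτ : 0 < τ.im) :
    Tendsto (fun u ↦ u ^ 3 * altLamSum 0 1 τ u) (nhdsWithin 0 {0}ᶜ) (nhds 0) :=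
  tendsto_pow_mul_lamSum_zero (summable_norm_pow_mul_altSq 0 hτ) one_ne_zero (by norm_num) hτ

lemma jTheta_add_half_add_tau (u τ : ℂ) :
    jTheta (u + τ + 1 / 2) τ =
      cexp (-π * I * τ) * (expTwoPi u)⁻¹ * jTheta (u + 1 / 2) τ := by
  rw [add_right_comm, jTheta_add_tau, expTwoPi_add, expTwoPi_half, mul_neg_one, inv_neg]
  ring

/-- The quotient of the theta functions that governs the heat operator. -/
theorem cube_jTheta_mul {τ u : ℂ} (hτ : 0 < τ.im) (hu : OffLattice τ u) :
    jTheta u τ ^ 3 * (altTheta τ * heatSum τ u - 4 * altThetaSq τ * altLamSum 0 1 τ u) =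
      -I * altTheta τ * dedekindEta τ ^ 10 / dedekindEta (2 * τ) ^ 2 * jTheta (u + 1 / 2) τ := by
  set C := -I * altTheta τ * dedekindEta τ ^ 10 / dedekindEta (2 * τ) ^ 2 with hC
  set G : ℂ → ℂ := fun u ↦ altTheta τ * heatSum τ u - 4 * altThetaSq τ * altLamSum 0 1 τ u with hG
  set J : ℂ → ℂ := fun u ↦ jTheta u τ ^ 2 * G u - C * (jTheta (u + 1 / 2) τ / jTheta u τ) with hJ
  have hη := dedekindEta_ne_zero hτ
  have hη2 := dedekindEta_ne_zero (two_mul_im_pos hτ)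
  have hπ : (π : ℂ) ≠ 0 := by exact_mod_cast Real.pi_ne_zero
  have hτJ : ∀ u, OffLattice τ u → J (u + τ) = -1 * J u := by
    intro u hu
    have hGu : G (u + τ) = -(expTwoPi τ * expTwoPi u ^ 2) * G u := by
      simp only [hG]
      rw [heatSum_add_tau hτ hu, altLamSum_zero_one_add_tau hτ hu]
      ring
    have h2 : cexp (-π * I * τ) ^ 2 * expTwoPi τ = 1 := by
      rw [expTwoPi, ← Complex.exp_nat_mul, ← Complex.exp_add, ← Complex.exp_zero]
      congr 1; push_cast; ring
    have h3 := expTwoPi_ne_zero u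
    have h4 := jTheta_ne_zero hτ hu
    have h5 := Complex.exp_ne_zero (-π * I * τ)
    simp only [hJ]
    rw [hGu, jTheta_add_half_add_tau, jTheta_add_tau]
    generalize cexp (-π * I * τ) = E at *
    field_simp
    linear_combination (-(jTheta u τ ^ 3 * G u)) * h2
  have hper : ∃ c, ∀ u, OffLattice τ u → J u = c := by
    refine exists_eq_const_of_quasiperiodic (ε := -1) hτ (by simp) ?_ ?_ hτJ ?_
    · intro u hu
      have h1 := differentiableAt_heatSum hτ hu
      have h2 := (hasDerivAt_altLamSum 0 one_ne_zero hτ hu).differentiableAt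
      have h3 := differentiable_jTheta hτ u
      have h4 : DifferentiableAt ℂ (fun u ↦ jTheta (u + 1 / 2) τ) u :=
        (differentiable_jTheta hτ (u + 1 / 2)).comp u (f := fun u : ℂ ↦ u + 1 / 2) (by fun_prop)
      exact ((h3.pow 2).mul ((h1.const_mul _).sub (h2.const_mul _))).sub
        ((h4.div h3 (jTheta_ne_zero hτ hu)).const_mul C)
    · intro u hu
      simp only [hJ, hG]
      rw [heatSum_add_one, altLamSum_add_one, add_right_comm, jTheta_add_one, jTheta_add_one,
        neg_div_neg_eq, neg_sq]
    · have h1 := tendsto_jTheta_div hτ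
      have h2 := ((tendsto_cube_mul_heatSum hτ).const_mul (altTheta τ)).sub
        ((tendsto_cube_mul_altLamSum hτ).const_mul (4 * altThetaSq τ))
      have hne : -2 * π * dedekindEta τ ^ 3 ≠ 0 := by simp [hπ, hη]
      have h3 : Tendsto (fun u ↦ jTheta (u + 1 / 2) τ) (nhdsWithin 0 {0}ᶜ)
          (nhds (jTheta (1 / 2) τ)) := by
        have : Continuous fun u ↦ jTheta (u + 1 / 2) τ :=
          (differentiable_jTheta hτ).continuous.comp (by fun_prop)
        simpa using (this.tendsto 0).mono_left (nhdsWithin_le_nhds (s := {0}ᶜ))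
      have h4 := ((h1.pow 2).mul h2).sub ((h3.div h1 hne).const_mul C)
      have he : (-2 * π * dedekindEta τ ^ 3) ^ 2 *
          (altTheta τ * (2 * (-(2 * π * I)⁻¹) ^ 3) - 4 * altThetaSq τ * 0) -
          C * (jTheta (1 / 2) τ / (-2 * π * dedekindEta τ ^ 3)) = 0 := by
        have h5 : jTheta (1 / 2) τ = -2 * dedekindEta (2 * τ) ^ 2 / dedekindEta τ := by
          rw [← jTheta_half_mul_eta hτ, mul_div_cancel_right₀ _ hη]
        have hI := I_ne_zero
        rw [h5, hC]
        field_simp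
        linear_combination (dedekindEta τ ^ 6 * altTheta τ) * I_pow_four
      rw [he] at h4
      refine h4.congr' ?_
      filter_upwards [self_mem_nhdsWithin, eventually_offLattice hτ 0] with u hu hu'
      have hu0 : u ≠ 0 := hu
      have h6 := jTheta_ne_zero hτ hu'
      simp only [hJ, hG, Pi.div_apply]
      field_simp
  obtain ⟨c, hc⟩ := hper
  have h0 : J u = 0 := by
    have h1 := hτJ u hu
    rw [hc _ (offLattice_add_tau hu), hc u hu, neg_one_mul] at h1
    rw [hc u hu]
    exact self_eq_neg.mp h1
  have h4 := jTheta_ne_zero hτ hu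
  have h5 : jTheta u τ ^ 2 * G u = C * (jTheta (u + 1 / 2) τ / jTheta u τ) := sub_eq_zero.mp h0
  calc jTheta u τ ^ 3 * G u = jTheta u τ * (jTheta u τ ^ 2 * G u) := by ring
    _ = C * jTheta (u + 1 / 2) τ := by rw [h5]; field_simp

lemma offLattice_two_mul_of_ne {τ u : ℂ} (hu : ∀ m n : ℤ, u ≠ (m : ℂ) * τ + (n : ℂ) / 2) :
    OffLattice (2 * τ) (2 * u) := by
  intro k h
  obtain ⟨n, hn⟩ := expTwoPi_eq_one_iff.mp h
  exact hu (-k) n (by push_cast; linear_combination hn / 2)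

/-- The heat operator maps the Lambert-type series to the heat sum. -/
lemma heat_operator_altLamSum {τ u : ℂ} (hτ : 0 < τ.im) (hu : OffLattice τ u) :
    8 * π * I * deriv (fun t ↦ I / altTheta t * altLamSum 0 1 t u) τ +
      iteratedDeriv 2 (fun w ↦ I / altTheta τ * altLamSum 0 1 τ w) u =
    -4 * π ^ 2 * I / altTheta τ ^ 2 *
      (altTheta τ * heatSum τ u - 4 * altThetaSq τ * altLamSum 0 1 τ u) := by
  have hθ := altTheta_ne_zero hτ
  have hdt : HasDerivAt (fun t ↦ I / altTheta t * altLamSum 0 1 t u) _ τ :=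
    ((hasDerivAt_const τ I).div (hasDerivAt_tsum_altSq hτ) hθ).mul (hasDerivAt_altLamSum_snd hτ hu)
  have hdu : deriv (fun w ↦ I / altTheta τ * altLamSum 0 1 τ w) =ᶠ[nhds u] fun w ↦
      I / altTheta τ * (2 * π * I * (1 : ℕ) * (altLamSum 0 1 τ w + altLamSum 0 (1 + 1) τ w)) := by
    filter_upwards [hu.eventually hτ] with w hw
    exact ((hasDerivAt_altLamSum 0 one_ne_zero hτ hw).const_mul _).deriv
  have hduu : HasDerivAt (fun w ↦ I / altTheta τ * (2 * π * I * (1 : ℕ) *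
      (altLamSum 0 1 τ w + altLamSum 0 (1 + 1) τ w))) _ u :=
    (((hasDerivAt_altLamSum 0 one_ne_zero hτ hu).add
      (hasDerivAt_altLamSum 0 two_ne_zero hτ hu)).const_mul _).const_mul _
  rw [iteratedDeriv_succ, iteratedDeriv_one, hdu.deriv_eq, hduu.deriv, hdt.deriv]
  rw [heatSum, altThetaSq, Pi.div_apply, ← altTheta.eq_def]
  generalize ∑' n : ℤ, (n : ℂ) ^ 2 * altSq τ n = Θ
  push_cast
  field_simp
  ring_nf
  simp only [I_sq]
  ring

/-- The heat-operator form of the overpartition PDE. -/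
theorem overpartition_pde_heat (τ u : ℂ) (hτ : 0 < τ.im)
    (hu : ∀ m n : ℤ, u ≠ (m : ℂ) * τ + (n : ℂ) / 2) :
    jTheta u τ ^ 3 *
      (8 * π * I * deriv (fun t : ℂ =>
          dedekindEta (2 * t) ^ 4 / (dedekindEta t ^ 2 * jTheta (2 * u) (2 * t))
            + Complex.exp (-π * I * t / 2) * Complex.exp (2 * π * I * u) *
                lerchMu (2 * u) t (2 * t)) τ
        + iteratedDeriv 2 (fun w : ℂ =>
          dedekindEta (2 * τ) ^ 4 / (dedekindEta τ ^ 2 * jTheta (2 * w) (2 * τ))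
            + Complex.exp (-π * I * τ / 2) * Complex.exp (2 * π * I * w) *
                lerchMu (2 * w) τ (2 * τ)) u)
    = -4 * π^2 * (dedekindEta τ ^ 8 / dedekindEta (2 * τ)) * jTheta (u + 1/2) τ := by
  have hu2 := offLattice_two_mul_of_ne hu
  have hτ2 := two_mul_im_pos hτ
  have hoff := offLattice_of_two_mul hu2
  have hev := hu2.eventually_prod hτ2
  have ht : Tendsto (fun t : ℂ ↦ (2 * u, 2 * t)) (nhds τ) (nhds (2 * u, 2 * τ)) :=
    (by fun_prop : Continuous fun t : ℂ ↦ (2 * u, 2 * t)).tendsto τ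
  have hw : Tendsto (fun w : ℂ ↦ (2 * w, 2 * τ)) (nhds u) (nhds (2 * u, 2 * τ)) :=
    (by fun_prop : Continuous fun w : ℂ ↦ (2 * w, 2 * τ)).tendsto u
  have him : ∀ᶠ t : ℂ in nhds τ, 0 < t.im := 
    (Complex.continuous_im.tendsto τ).eventually_const_lt hτ
  have e1 : (fun t : ℂ =>
      dedekindEta (2 * t) ^ 4 / (dedekindEta t ^ 2 * jTheta (2 * u) (2 * t))
        + Complex.exp (-π * I * t / 2) * Complex.exp (2 * π * I * u) *
          lerchMu (2 * u) t (2 * t)) =ᶠ[nhds τ] fun t ↦ I / altTheta t * altLamSum 0 1 t u := by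
    filter_upwards [ht.eventually hev, him] with t h h' using bracket_eq h' h
  have e2 : (fun w : ℂ =>
      dedekindEta (2 * τ) ^ 4 / (dedekindEta τ ^ 2 * jTheta (2 * w) (2 * τ))
        + Complex.exp (-π * I * τ / 2) * Complex.exp (2 * π * I * w) *
          lerchMu (2 * w) τ (2 * τ)) =ᶠ[nhds u] fun w ↦ I / altTheta τ * altLamSum 0 1 τ w := by
    filter_upwards [hw.eventually hev] with w h using bracket_eq hτ h
  rw [e1.deriv_eq, e2.iteratedDeriv_eq 2, heat_operator_altLamSum hτ hoff, mul_left_comm,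
    cube_jTheta_mul hτ hoff]
  have h1 := altTheta_ne_zero hτ
  have h2 := dedekindEta_ne_zero hτ2
  have h3 := dedekindEta_ne_zero hτ
  have h4 : dedekindEta τ ^ 10 = altTheta τ * dedekindEta (2 * τ) * dedekindEta τ ^ 8 := by
    rw [altTheta_mul_eta hτ]; ring
  rw [h4]
  field_simp
  linear_combination jTheta ((2 * u + 1) / 2) τ * I_sq

end
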